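/- arXiv:0902.4454 — 3 statements merged into one kernel-verified Lean document; each statement's English description precedes it below -/
import Mathlib

section
/- Let n be a positive integer and let ε ∈ ℂ be a primitive 2n-th root of unity. A nonzero binary form f ∈ ℂ[x,y] is semi-invariant under the diagonal matrix diag(ε, ε⁻¹) ∈ SL(2,ℂ) if and only if f is a nonzero scalar multiple of x^α y^β ∏_{i=1}^N (λ_i x^n + μ_i y^n) for some nonnegative integers α, β, N and pairs (λ_i, μ_i) ∈ ℂ² \ {(0,0)}. -/
open MvPolynomial Matrix

noncomputable section

/-- Polynomials in two variables `x = X 0`, `y = X 1` over `ℂ`. -/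
abbrev BPoly : Type := MvPolynomial (Fin 2) ℂ

/-- The variable `x`. -/
def Px : BPoly := X 0

/-- The variable `y`. -/
def Py : BPoly := X 1

/-- Substitution action of a 2×2 matrix on polynomials in two variables:
for `A = [[p,q],[r,s]]`, `(f·A)(x,y) = f(px+qy, rx+sy)`. -/
def matAct (A : Matrix (Fin 2) (Fin 2) ℂ) (f : BPoly) : BPoly :=
  bind₁ (fun i => C (A i 0) * Px + C (A i 1) * Py) f

/-- `f` is semi-invariant under `A`: `f·A = c·f` for some nonzero scalar `c`. -/
def SemiInv (A : Matrix (Fin 2) (Fin 2) ℂ) (f : BPoly) : Prop :=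
  ∃ c : ℂ, c ≠ 0 ∧ matAct A f = C c * f

/-- The stabilizer of `f` inside `SL(2,ℂ)`: all matrices under which `f` is
semi-invariant. -/
def Stab (f : BPoly) : Set (SpecialLinearGroup (Fin 2) ℂ) :=
  {A | SemiInv (A : Matrix (Fin 2) (Fin 2) ℂ) f}

/-- `f` is a (nonzero) binary form: nonzero and homogeneous of some degree. -/
def IsBinaryForm (f : BPoly) : Prop :=
  f ≠ 0 ∧ ∃ d : ℕ, f.IsHomogeneous d

/-- `f` is `SL(2,ℂ)`-equivalent to `g` up to a nonzero scalar:
`c·(f·A) = g` for some `A ∈ SL(2,ℂ)` and `c ≠ 0`. -/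
def EquivForm (f g : BPoly) : Prop :=
  ∃ A : SpecialLinearGroup (Fin 2) ℂ, ∃ c : ℂ, c ≠ 0 ∧
    C c * matAct (A : Matrix (Fin 2) (Fin 2) ℂ) f = g


theorem coeff_bind₁_C_mul_X {σ R : Type*} [CommSemiring R] (a : σ → R) (f : MvPolynomial σ R)
    (m : σ →₀ ℕ) :
    coeff m (bind₁ (fun i => C (a i) * X i) f) = (m.prod fun i k => a i ^ k) * coeff m f := by
  classical
  induction f using MvPolynomial.induction_on' with
  | monomial u r =>
    have h : bind₁ (fun i => C (a i) * X i) (monomial u r)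
        = monomial u ((u.prod fun i k => a i ^ k) * r) := by
      rw [bind₁_monomial, monomial_eq (s := u)]
      simp only [mul_pow, Finsupp.prod, Finset.prod_mul_distrib, C_mul, map_prod, C_pow]
      ring
    rw [h, coeff_monomial, coeff_monomial]
    split_ifs with h
    · rw [h]
    · simp
  | add p q hp hq => simp only [map_add, coeff_add, hp, hq, mul_add]

theorem matAct_diag (a b : ℂ) (f : BPoly) :
    matAct !![a, 0; 0, b] f = bind₁ (fun i => C (![a, b] i) * X i) f := by
  unfold matAct
  congr 2
  funext i
  fin_cases i <;> simp [Px, Py]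

theorem coeff_matAct_diag (a b : ℂ) (f : BPoly) (m : Fin 2 →₀ ℕ) :
    coeff m (matAct !![a, 0; 0, b] f) = a ^ m 0 * b ^ m 1 * coeff m f := by
  rw [matAct_diag, coeff_bind₁_C_mul_X, Finsupp.prod_fintype _ _ (by simp)]
  simp

theorem exists_homogenize_eq {R : Type*} [CommSemiring R] {d : ℕ} {f : MvPolynomial (Fin 2) R}
    (hf : f.IsHomogeneous d) : ∃ q : Polynomial R, q.natDegree ≤ d ∧ q.homogenize d = f := by
  let e : ℕ → (Fin 2 →₀ ℕ) := fun k => Finsupp.single 0 k + Finsupp.single 1 (d - k)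
  refine ⟨∑ k ∈ Finset.range (d + 1), Polynomial.monomial k (coeff (e k) f), ?_, ?_⟩
  · refine Polynomial.natDegree_sum_le_of_forall_le _ _ fun k hk => ?_
    exact (Polynomial.natDegree_monomial_le _).trans (by simpa [Nat.lt_succ_iff] using hk)
  · ext m
    rw [Polynomial.coeff_homogenize]
    split_ifs with h
    · have hm : e (m 0) = m := by
        ext i
        fin_cases i
        · simp [e]
        · simp [e]; omega
      rw [Polynomial.finsetSum_coeff, Finset.sum_eq_single (m 0)]
      · simp [hm]
      · intro b _ hb
        simp [Polynomial.coeff_monomial, hb]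
      · intro h'
        simp at h'
        omega
    · symm
      apply hf.coeff_eq_zero
      rwa [Finsupp.degree_eq_sum, Fin.sum_univ_two]

theorem exists_eq_X_pow_mul_expand {R : Type*} [CommSemiring R] {n r : ℕ} (hn : 0 < n)
    {q : Polynomial R} (hq : ∀ k, q.coeff k ≠ 0 → k % n = r) :
    ∃ p : Polynomial R, q = Polynomial.X ^ r * Polynomial.expand R n p := by
  refine ⟨Polynomial.contract n (Polynomial.divX^[r] q), ?_⟩
  have hdiv : ∀ (j k : ℕ), (Polynomial.divX^[j] q).coeff k = q.coeff (k + j) := by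
    intro j
    induction j with
    | zero => simp
    | succ j ih =>
      intro k
      rw [Function.iterate_succ_apply', Polynomial.coeff_divX, ih]
      congr 1
      ring
  ext k
  rw [Polynomial.coeff_X_pow_mul', Polynomial.coeff_expand hn, Polynomial.coeff_contract hn.ne',
    hdiv]
  by_cases hk : k % n = r
  · have hrk : r ≤ k := hk ▸ Nat.mod_le k n
    have hdvd : n ∣ k - r := hk ▸ Nat.dvd_sub_mod k
    rw [if_pos hrk, if_pos hdvd, Nat.div_mul_cancel hdvd, Nat.sub_add_cancel hrk]
  · have h0 : q.coeff k = 0 := by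
      by_contra h
      exact hk (hq k h)
    rw [h0]
    split_ifs with h1 h2
    · rw [Nat.div_mul_cancel h2, Nat.sub_add_cancel h1, h0]
    · rfl
    · rfl

theorem exists_eq_C_mul_prod {K : Type*} [Field K] [IsAlgClosed K] (p : Polynomial K) :
    ∃ r : Fin p.natDegree → K,
      p = Polynomial.C p.leadingCoeff * ∏ i, (Polynomial.X - Polynomial.C (r i)) := by
  have hs := IsAlgClosed.splits p
  have hc : p.roots.toList.length = p.natDegree := by
    rw [Multiset.length_toList, hs.natDegree_eq_card_roots]
  refine ⟨fun i => p.roots.toList.get (i.cast hc.symm), ?_⟩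
  have h1 : (p.roots.map (Polynomial.X - Polynomial.C ·)).prod
      = ∏ i, (Polynomial.X - Polynomial.C (p.roots.toList.get i)) := by
    conv_lhs => rw [← Multiset.coe_toList p.roots, Multiset.map_coe, Multiset.prod_coe]
    rw [← Fin.prod_univ_fun_getElem]
    rfl
  conv_lhs => rw [hs.eq_prod_roots, h1]
  congr 1
  exact Fintype.prod_equiv (finCongr hc) _ _ (by simp)

theorem homogenize_X_pow_mul_expand {K : Type*} [Field K] [IsAlgClosed K]
    {n r d : ℕ} (hn : 0 < n) {p : Polynomial K} (hp : p ≠ 0)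
    (hd : (Polynomial.X ^ r * Polynomial.expand K n p).natDegree ≤ d) :
    ∃ (b : ℕ) (z : Fin p.natDegree → K),
      (Polynomial.X ^ r * Polynomial.expand K n p).homogenize d =
        C p.leadingCoeff * (X 0 ^ r * X 1 ^ b * ∏ i, (X 0 ^ n - C (z i) * X 1 ^ n)) := by
  obtain ⟨z, hz⟩ := exists_eq_C_mul_prod p
  have hexp : Polynomial.expand K n p ≠ 0 := by
    simpa [Polynomial.expand_eq_zero hn] using hp
  rw [Polynomial.natDegree_mul (pow_ne_zero _ Polynomial.X_ne_zero) hexp,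
    Polynomial.natDegree_X_pow, Polynomial.natDegree_expand] at hd
  obtain ⟨b, rfl⟩ := Nat.exists_eq_add_of_le hd
  refine ⟨b, z, ?_⟩
  have hfac : Polynomial.X ^ r * Polynomial.expand K n p = Polynomial.C p.leadingCoeff *
      (Polynomial.X ^ r * (∏ i, (Polynomial.X ^ n - Polynomial.C (z i))) * 1) := by
    conv_lhs => rw [hz]
    simp only [map_mul, map_prod, map_sub, Polynomial.expand_X, Polynomial.expand_C]
    ring
  have hdeg : ∀ i ∈ (Finset.univ : Finset (Fin p.natDegree)),
      (Polynomial.X ^ n - Polynomial.C (z i)).natDegree ≤ n := fun i _ => by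
    simp
  have hprod := Polynomial.homogenize_finsetProd hdeg
  have hpdeg : (∏ i, (Polynomial.X ^ n - Polynomial.C (z i))).natDegree
      ≤ ∑ _i : Fin p.natDegree, n :=
    (Polynomial.natDegree_prod_le _ _).trans (Finset.sum_le_sum hdeg)
  have hsum : p.natDegree * n = ∑ _i : Fin p.natDegree, n := by simp
  rw [hfac, Polynomial.homogenize_C_mul, hsum,
    Polynomial.homogenize_mul _ _ _ (by simp), Polynomial.homogenize_mul _ _ (by simp) hpdeg,
    hprod]
  · simp only [Polynomial.homogenize_sub, Polynomial.homogenize_C,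
      Polynomial.homogenize_X_pow le_rfl, Polynomial.homogenize_one]
    simp only [Nat.sub_self, pow_zero, mul_one]
    ring
  · refine Polynomial.natDegree_mul_le.trans (add_le_add (by simp) hpdeg)

theorem IsPrimitiveRoot.mod_eq_mod_of_pow_mul_inv_pow_eq {K : Type*} [Field K] {n : ℕ}
    (hn : 0 < n) {ε : K} (hε : IsPrimitiveRoot ε (2 * n)) {a b a' b' : ℕ} (hd : a + b = a' + b')
    (h : ε ^ a * ε⁻¹ ^ b = ε ^ a' * ε⁻¹ ^ b') : a % n = a' % n := by
  have h0 : ε ≠ 0 := hε.ne_zero (by omega)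
  have h1 : ε ^ ((2 * a : ℤ) - 2 * a') = 1 := by
    have e : ((2 * a : ℤ) - 2 * a') = (a - b) - (a' - b') := by omega
    rw [e, zpow_sub₀ h0, div_eq_one_iff_eq (zpow_ne_zero _ h0), zpow_sub₀ h0, zpow_sub₀ h0]
    simpa [div_eq_mul_inv] using h
  rw [hε.zpow_eq_one_iff_dvd] at h1
  push_cast at h1
  rw [← mul_sub] at h1
  have h2 : (n : ℤ) ∣ a - a' := (mul_dvd_mul_iff_left two_ne_zero).1 h1
  exact ((Nat.modEq_iff_dvd.2 h2).symm : a ≡ a' [MOD n])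

/-- Klein's classification of semi-invariants of the cyclic group `Cₙ`:
a nonzero binary form is semi-invariant under `diag(ε, ε⁻¹)`, for `ε` a
primitive `2n`-th root of unity, iff it is a nonzero scalar multiple of
`x^α y^β ∏ᵢ (λᵢ xⁿ + μᵢ yⁿ)`. -/
theorem semiInv_cyclic_iff
    (n : ℕ) (hn : 0 < n) (ε : ℂ) (hε : IsPrimitiveRoot ε (2 * n))
    (f : BPoly) (hbf : IsBinaryForm f) :
    SemiInv !![ε, 0; 0, ε⁻¹] f ↔
      ∃ c : ℂ, c ≠ 0 ∧ ∃ (α β N : ℕ) (lam mu : Fin N → ℂ),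
        (∀ i, (lam i, mu i) ≠ (0, 0)) ∧
        f = C c * (Px ^ α * Py ^ β *
          ∏ i : Fin N, (C (lam i) * Px ^ n + C (mu i) * Py ^ n)) := by
  have h0 : ε ≠ 0 := hε.ne_zero (by omega)
  constructor
  · rintro ⟨c, -, hc⟩
    obtain ⟨hf, d, hd⟩ := hbf
    obtain ⟨q, hqd, rfl⟩ := exists_homogenize_eq hd
    have hq : q ≠ 0 := by
      rintro rfl
      simp at hf
    have key : ∀ k, q.coeff k ≠ 0 → k ≤ d ∧ ε ^ k * ε⁻¹ ^ (d - k) = c := by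
      intro k hk
      have hkd : k ≤ d := (Polynomial.le_natDegree_of_ne_zero hk).trans hqd
      have h := congrArg (coeff (Finsupp.single 0 k + Finsupp.single 1 (d - k))) hc
      rw [coeff_matAct_diag, coeff_C_mul, Polynomial.coeff_homogenize] at h
      simp [hkd, hk] at h
      exact ⟨hkd, by simpa using h⟩
    have hmod : ∀ k, q.coeff k ≠ 0 → k % n = q.natDegree % n := by
      intro k hk
      obtain ⟨h1, h2⟩ := key k hk
      obtain ⟨h3, h4⟩ := key q.natDegree (by simpa using hq)
      exact hε.mod_eq_mod_of_pow_mul_inv_pow_eq hn (by omega) (h2.trans h4.symm)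
    obtain ⟨p, hp⟩ := exists_eq_X_pow_mul_expand hn hmod
    have hp0 : p ≠ 0 := by
      rintro rfl
      simp at hp
      exact hq hp
    generalize q.natDegree % n = r at hp
    subst hp
    obtain ⟨b, z, hz⟩ := homogenize_X_pow_mul_expand hn hp0 hqd
    refine ⟨p.leadingCoeff, by simpa using hp0, r, b, p.natDegree, fun _ => 1, fun i => -z i,
      by simp, ?_⟩
    rw [hz]
    simp [Px, Py, sub_eq_add_neg]
  · rintro ⟨c, -, α, β, N, lam, mu, -, rfl⟩
    have hn1 : ε⁻¹ ^ n = ε ^ n := by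
      rw [inv_pow]
      exact inv_eq_of_mul_eq_one_right (by rw [← pow_add, ← two_mul, hε.pow_eq_one])
    refine ⟨ε ^ α * ε⁻¹ ^ β * (ε ^ n) ^ N, by simp [h0], ?_⟩
    have hfac : ∀ i, matAct !![ε, 0; 0, ε⁻¹] (C (lam i) * Px ^ n + C (mu i) * Py ^ n)
        = C (ε ^ n) * (C (lam i) * Px ^ n + C (mu i) * Py ^ n) := by
      intro i
      rw [matAct_diag]
      simp only [Px, Py, map_add, map_mul, map_pow, bind₁_X_right, bind₁_C_right,
        Matrix.cons_val_zero, Matrix.cons_val_one, mul_pow]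
      rw [← C_pow (a := ε⁻¹), hn1, C_pow]
      ring
    simp only [matAct_diag] at hfac ⊢
    simp only [map_mul, map_prod, hfac, Finset.prod_mul_distrib]
    simp only [Px, Py, map_pow, bind₁_X_right, bind₁_C_right,
      Matrix.cons_val_zero, Matrix.cons_val_one, mul_pow, Finset.prod_const, Finset.card_univ,
      Fintype.card_fin]
    ring

end
end

section
/- Let n be a positive integer, ε ∈ ℂ a primitive 2n-th root of unity, and let D_n ⊂ SL(2,ℂ) be the subgroup generated by diag(ε, ε⁻¹) and [[0,i],[i,0]]. A nonzero binary form f ∈ ℂ[x,y] is semi-invariant under every element of D_n if and only if f is a nonzero scalar multiple of (xⁿ+yⁿ)^α (xⁿ−yⁿ)^β (xy)^γ ∏_{i=1}^N (λ_i (xⁿ+yⁿ)² + μ_i (xⁿ−yⁿ)²) for some nonnegative integers α, β, γ, N and pairs (λ_i, μ_i) ∈ ℂ² \ {(0,0)}. -/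
open MvPolynomial Matrix

noncomputable section

/-- The binary form `∑ a_k U^k V^(d-k)` evaluated at two polynomials `U`, `V`. -/
def binarySum (d : ℕ) (a : ℕ → ℂ) (U V : BPoly) : BPoly :=
  ∑ k ∈ Finset.range (d + 1), C (a k) * U ^ k * V ^ (d - k)

lemma map_binarySum (φ : BPoly →ₐ[ℂ] BPoly) (d : ℕ) (a : ℕ → ℂ) (U V : BPoly) :
    φ (binarySum d a U V) = binarySum d a (φ U) (φ V) := by
  have hC : ∀ c : ℂ, φ (C c) = C c := fun c => φ.commutes c
  simp [binarySum, map_sum, hC]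

lemma C_mul_binarySum (c : ℂ) (d : ℕ) (a : ℕ → ℂ) (U V : BPoly) :
    C c * binarySum d a U V = binarySum d (fun k => c * a k) U V := by
  simp only [binarySum, Finset.mul_sum, C_mul]
  exact Finset.sum_congr rfl fun k _ => by ring

lemma binarySum_C_mul (u v : ℂ) (d : ℕ) (a : ℕ → ℂ) (U V : BPoly) :
    binarySum d a (C u * U) (C v * V) =
      binarySum d (fun k => u ^ k * v ^ (d - k) * a k) U V := by
  simp only [binarySum, C_mul, mul_pow, C_pow]
  exact Finset.sum_congr rfl fun k _ => by ring

lemma binarySum_swap (d : ℕ) (a : ℕ → ℂ) (U V : BPoly) :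
    binarySum d a V U = binarySum d (fun k => a (d - k)) U V := by
  unfold binarySum
  rw [← Finset.sum_range_reflect]
  refine Finset.sum_congr rfl fun k hk => ?_
  have hk' : k ≤ d := Nat.lt_succ_iff.mp (Finset.mem_range.mp hk)
  rw [show d + 1 - 1 - k = d - k by omega, Nat.sub_sub_self hk']
  ring

lemma binarySum_congr {d : ℕ} {a b : ℕ → ℂ} (h : ∀ k ≤ d, a k = b k) (U V : BPoly) :
    binarySum d a U V = binarySum d b U V :=
  Finset.sum_congr rfl fun k hk => by rw [h k (Nat.lt_succ_iff.mp (Finset.mem_range.mp hk))]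

lemma homogenize_eq_binarySum (p : Polynomial ℂ) (d : ℕ) :
    p.homogenize d = binarySum d p.coeff Px Py := by
  rw [Polynomial.homogenize, binarySum, Finset.Nat.sum_antidiagonal_eq_sum_range_succ_mk]
  refine Finset.sum_congr rfl fun k _ => ?_
  rw [MvPolynomial.monomial_eq, Finsupp.prod_fintype _ _ (by simp)]
  simp [Fin.prod_univ_two, Px, Py, mul_assoc]

lemma exists_eq_binarySum {f : BPoly} {d : ℕ} (hf : f.IsHomogeneous d) :
    ∃ a : ℕ → ℂ, f = binarySum d a Px Py :=
  ⟨_, (Polynomial.homogenize_eq_of_isHomogeneous hf rfl).symm.trans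
    (homogenize_eq_binarySum _ _)⟩

lemma binarySum_injective {d : ℕ} {a b : ℕ → ℂ}
    (h : binarySum d a Px Py = binarySum d b Px Py) : ∀ k ≤ d, a k = b k := by
  have key : ∀ c : ℕ → ℂ, ∀ k ≤ d,
      (aeval ![Polynomial.X, (1 : Polynomial ℂ)] (binarySum d c Px Py)).coeff k = c k := by
    intro c k hk
    simp [binarySum, Px, Py, map_sum, Polynomial.coeff_X_pow,
      Nat.lt_succ_iff.mpr hk]
  intro k hk
  rw [← key a k hk, h, key b k hk]

lemma isHomogeneous_binarySum {d : ℕ} (a : ℕ → ℂ) {U V : BPoly}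
    (hU : U.IsHomogeneous 1) (hV : V.IsHomogeneous 1) :
    (binarySum d a U V).IsHomogeneous d := by
  refine IsHomogeneous.sum _ _ _ fun k hk => ?_
  have hk' : k ≤ d := Nat.lt_succ_iff.mp (Finset.mem_range.mp hk)
  have := ((isHomogeneous_C (Fin 2) (a k)).mul (hU.pow k)).mul (hV.pow (d - k))
  rwa [show 0 + 1 * k + 1 * (d - k) = d by omega] at this

/-- A binary form supported on an arithmetic progression of exponents is a monomial times a
binary form in powers. -/
lemma binarySum_of_support {n : ℕ} (hn : 0 < n) (r m t : ℕ) (a : ℕ → ℂ)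
    (h : ∀ k ≤ r + n * m + t, a k ≠ 0 → ∃ j ≤ m, k = r + n * j) (U V : BPoly) :
    binarySum (r + n * m + t) a U V =
      U ^ r * V ^ t * binarySum m (fun j => a (r + n * j)) (U ^ n) (V ^ n) := by
  unfold binarySum
  rw [Finset.mul_sum]
  symm
  refine Finset.sum_of_injOn (fun j => r + n * j) ?_ ?_ ?_ ?_
  · intro i _ j _ hij
    exact Nat.eq_of_mul_eq_mul_left hn (Nat.add_left_cancel hij)
  · intro j hj
    have hj' : j ≤ m := by simpa [Nat.lt_succ_iff] using hj
    have := Nat.mul_le_mul_left n hj'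
    simp only [Finset.coe_range, Set.mem_Iio]
    omega
  · intro k hk hk'
    have hkd : k ≤ r + n * m + t := Nat.lt_succ_iff.mp (Finset.mem_range.mp hk)
    by_cases hak : a k = 0
    · simp [hak]
    · obtain ⟨j, hj, rfl⟩ := h k hkd hak
      exact absurd ⟨j, by simpa [Nat.lt_succ_iff] using hj, rfl⟩ hk'
  · intro j hj
    have hj' : j ≤ m := Nat.lt_succ_iff.mp (Finset.mem_range.mp hj)
    obtain ⟨i, rfl⟩ := Nat.exists_eq_add_of_le hj'
    rw [show r + n * (j + i) + t - (r + n * j) = n * i + t by rw [Nat.mul_add]; omega,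
      show j + i - j = i by omega]
    ring

/-- Over `ℂ`, the homogenization of a nonzero polynomial is a product of linear forms. -/
lemma exists_homogenize_eq_prod (M : ℕ) (p : Polynomial ℂ) (hp : p ≠ 0) (hM : p.natDegree ≤ M) :
    ∃ c : ℂ, c ≠ 0 ∧ ∃ lam mu : Fin M → ℂ, (∀ i, (lam i, mu i) ≠ (0, 0)) ∧
      p.homogenize M = C c * ∏ i, (C (lam i) * Px + C (mu i) * Py) := by
  induction M generalizing p with
  | zero =>
    obtain ⟨c, rfl⟩ := Polynomial.natDegree_eq_zero.mp (Nat.le_zero.mp hM)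
    exact ⟨c, by simpa using hp, 0, 0, fun i => i.elim0, by simp⟩
  | succ M ih =>
    obtain ⟨q, hq, hqM, l, u, hlu, hpq⟩ : ∃ q : Polynomial ℂ, q ≠ 0 ∧ q.natDegree ≤ M ∧
        ∃ l u : ℂ, (l, u) ≠ (0, 0) ∧
          p.homogenize (M + 1) = (C l * Px + C u * Py) * q.homogenize M := by
      rcases Nat.le_or_eq_of_le_succ hM with h | h
      · refine ⟨p, hp, h, 0, 1, by simp, ?_⟩
        have := Polynomial.homogenize_mul (1 : Polynomial ℂ) p (m := 1) (by simp) h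
        rw [one_mul, add_comm 1 M] at this
        simp [this, Py]
      · have hdeg : p.degree ≠ 0 := by
          rw [Polynomial.degree_eq_natDegree hp, h]
          exact_mod_cast Nat.succ_ne_zero M
        obtain ⟨z, hz⟩ := IsAlgClosed.exists_root p hdeg
        obtain ⟨q, rfl⟩ := Polynomial.dvd_iff_isRoot.mpr hz
        have hq : q ≠ 0 := right_ne_zero_of_mul hp
        have hqM : q.natDegree ≤ M := by
          rw [Polynomial.natDegree_mul (left_ne_zero_of_mul hp) hq,
            Polynomial.natDegree_X_sub_C] at h
          omega
        refine ⟨q, hq, hqM, 1, -z, by simp, ?_⟩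
        rw [add_comm M 1, Polynomial.homogenize_mul _ _ (by simp) hqM]
        simp [Px, Py, sub_eq_add_neg]
    obtain ⟨c, hc, lam, mu, hne, hprod⟩ := ih q hq hqM
    refine ⟨c, hc, Fin.cons l lam, Fin.cons u mu,
      Fin.cases (by simpa using hlu) (by simpa using hne), ?_⟩
    rw [hpq, hprod, Fin.prod_univ_succ]
    simp only [Fin.cons_zero, Fin.cons_succ]
    ring

lemma exists_binarySum_eq_prod {M : ℕ} {e : ℕ → ℂ} {U V : BPoly} (h : binarySum M e U V ≠ 0) :
    ∃ c : ℂ, c ≠ 0 ∧ ∃ lam mu : Fin M → ℂ, (∀ i, (lam i, mu i) ≠ (0, 0)) ∧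
      binarySum M e U V = C c * ∏ i, (C (lam i) * U + C (mu i) * V) := by
  let p : Polynomial ℂ := ∑ k ∈ Finset.range (M + 1), Polynomial.monomial k (e k)
  have hcoeff : ∀ k ≤ M, p.coeff k = e k := by
    intro k hk
    simp [p, Polynomial.coeff_monomial, Nat.lt_succ_iff.mpr hk]
  have hpM : p.natDegree ≤ M := Polynomial.natDegree_sum_le_of_forall_le _ _ fun k hk =>
    (Polynomial.natDegree_monomial_le _).trans (Nat.lt_succ_iff.mp (Finset.mem_range.mp hk))
  have hsum : aeval ![U, V] (p.homogenize M) = binarySum M e U V := by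
    rw [homogenize_eq_binarySum, map_binarySum, binarySum_congr hcoeff]
    simp [Px, Py]
  have hp : p ≠ 0 := by
    intro hp
    rw [hp] at hsum
    exact h (by simpa using hsum.symm)
  obtain ⟨c, hc, lam, mu, hne, hprod⟩ := exists_homogenize_eq_prod M p hp hpM
  refine ⟨c, hc, lam, mu, hne, ?_⟩
  rw [← hsum, hprod]
  simp [Px, Py, map_prod, MvPolynomial.algebraMap_eq]

/-- A binary form in `X`, `Y` that is symmetric or antisymmetric under exchanging the variables
factors through `X + Y`, `X - Y` and forms `λ (X + Y)² + μ (X - Y)²`. -/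
lemma exists_binarySum_eq_of_symm {m : ℕ} {b : ℕ → ℂ} {σ : ℂ}
    (hb : ∀ j ≤ m, b (m - j) = σ * b j) {X' Y' : BPoly} (h : binarySum m b X' Y' ≠ 0) :
    ∃ c : ℂ, c ≠ 0 ∧ ∃ (α β N : ℕ) (lam mu : Fin N → ℂ),
      (∀ i, (lam i, mu i) ≠ (0, 0)) ∧
      binarySum m b X' Y' = C c * ((X' + Y') ^ α * (X' - Y') ^ β *
        ∏ i, (C (lam i) * (X' + Y') ^ 2 + C (mu i) * (X' - Y') ^ 2)) := by
  have hX : Px.IsHomogeneous 1 := isHomogeneous_X _ _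
  have hY : Py.IsHomogeneous 1 := isHomogeneous_X _ _
  have hhalf : (C (2⁻¹ : ℂ) : BPoly) * 2 = 1 := by
    rw [show (2 : BPoly) = C 2 from (map_ofNat C 2).symm, ← C_mul]
    norm_num
  obtain ⟨e, he⟩ := exists_eq_binarySum (isHomogeneous_binarySum (d := m) b
    (U := C 2⁻¹ * (Py + Px)) (V := C 2⁻¹ * (Py - Px))
    (by simpa using (isHomogeneous_C _ _).mul (hY.add hX))
    (by simpa using (isHomogeneous_C _ _).mul (hY.sub hX)))
  have hsubst : binarySum m b X' Y' = binarySum m e (X' - Y') (X' + Y') := by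
    have := congrArg (aeval ![X' - Y', X' + Y']) he
    simp only [map_binarySum] at this
    convert this using 1
    · congr 1
      · simp [Px, Py, MvPolynomial.algebraMap_eq]
        linear_combination (-X') * hhalf
      · simp [Px, Py, MvPolynomial.algebraMap_eq]
        linear_combination (-Y') * hhalf
    · simp [Px, Py]
  have hparity : ∀ k ≤ m, (-1) ^ k * e k = σ * e k := by
    have := congrArg (aeval ![-Px, Py]) he
    simp only [map_binarySum] at this
    rw [show aeval ![-Px, Py] (C 2⁻¹ * (Py + Px)) = C 2⁻¹ * (Py - Px) by
        simp [Px, Py, MvPolynomial.algebraMap_eq, sub_eq_add_neg],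
      show aeval ![-Px, Py] (C 2⁻¹ * (Py - Px)) = C 2⁻¹ * (Py + Px) by
        simp [Px, Py, MvPolynomial.algebraMap_eq],
      binarySum_swap, binarySum_congr hb, ← C_mul_binarySum, he, C_mul_binarySum,
      show aeval ![-Px, Py] Px = C (-1) * Px by simp [Px],
      show aeval ![-Px, Py] Py = C 1 * Py by simp [Py], binarySum_C_mul] at this
    intro k hk
    simpa using (binarySum_injective this k hk).symm
  obtain ⟨k₀, hk₀, hek₀⟩ : ∃ k ≤ m, e k ≠ 0 := by
    by_contra! h0
    exact h (by rw [hsubst, binarySum_congr h0]; simp [binarySum])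
  have hσ : σ = (-1) ^ k₀ := (mul_right_cancel₀ hek₀ (hparity k₀ hk₀)).symm
  obtain ⟨s, t, M, hs, hm⟩ : ∃ s t M, s = k₀ % 2 ∧ m = s + 2 * M + t ∧ t < 2 :=
    ⟨k₀ % 2, (m - k₀ % 2) % 2, (m - k₀ % 2) / 2, rfl, by omega, by omega⟩
  obtain ⟨hm, ht⟩ := hm
  have hsupp : ∀ k ≤ s + 2 * M + t, e k ≠ 0 → ∃ j ≤ M, k = s + 2 * j := by
    intro k hk hek
    have hpow : (-1 : ℂ) ^ k = (-1) ^ k₀ := by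
      rw [← hσ]; exact mul_right_cancel₀ hek (hparity k (hm ▸ hk))
    have hmod : k % 2 = k₀ % 2 := by
      rcases Nat.even_or_odd k with h1 | h1 <;> rcases Nat.even_or_odd k₀ with h2 | h2
      · rw [Nat.even_iff.mp h1, Nat.even_iff.mp h2]
      · rw [h1.neg_one_pow, h2.neg_one_pow] at hpow; norm_num at hpow
      · rw [h1.neg_one_pow, h2.neg_one_pow] at hpow; norm_num at hpow
      · rw [Nat.odd_iff.mp h1, Nat.odd_iff.mp h2]
    exact ⟨(k - s) / 2, by omega, by omega⟩
  have hfac := binarySum_of_support two_pos s M t e hsupp (X' - Y') (X' + Y')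
  rw [← hm, ← hsubst] at hfac
  rw [hfac] at h
  obtain ⟨c, hc, lam, mu, hne, hprod⟩ := exists_binarySum_eq_prod (right_ne_zero_of_mul h)
  refine ⟨c, hc, t, s, M, mu, lam, fun i hi => hne i ?_, ?_⟩
  · simp_all
  · rw [hfac, hprod]
    simp only [add_comm (C (mu _) * _)]
    ring

/-- A form invariant up to scalars under `diag(ε, ε⁻¹)` and the (scaled) swap is `(xy)^γ` times a
form in `xⁿ`, `yⁿ` that is symmetric up to a scalar. -/
lemma exists_eq_of_semiInv {n : ℕ} (hn : 0 < n) {ε : ℂ} (hε : IsPrimitiveRoot ε (2 * n))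
    {f : BPoly} (hbf : IsBinaryForm f) (hfD : SemiInv !![ε, 0; 0, ε⁻¹] f)
    (hfS : SemiInv !![0, Complex.I; Complex.I, 0] f) :
    ∃ (γ m : ℕ) (b : ℕ → ℂ) (σ : ℂ), (∀ j ≤ m, b (m - j) = σ * b j) ∧
      f = (Px * Py) ^ γ * binarySum m b (Px ^ n) (Py ^ n) := by
  obtain ⟨hf0, d, hd⟩ := hbf
  obtain ⟨a, rfl⟩ := exists_eq_binarySum hd
  have hε0 : ε ≠ 0 := hε.ne_zero (by omega)
  obtain ⟨cD, -, hD⟩ := hfD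
  obtain ⟨cS, hcS, hS⟩ := hfS
  have hD' : ∀ k ≤ d, a k ≠ 0 → ε ^ (2 * k) = cD * ε ^ d := by
    rw [matAct, map_binarySum, C_mul_binarySum] at hD
    simp only [Px, Py, bind₁_X_right] at hD
    simp only [of_apply, cons_val', cons_val_zero, cons_val_one, cons_val_fin_one, map_zero, zero_mul,
      zero_add, add_zero] at hD
    rw [binarySum_C_mul] at hD
    intro k hk hak
    have := mul_right_cancel₀ hak (binarySum_injective hD k hk)
    obtain ⟨i, rfl⟩ := Nat.exists_eq_add_of_le hk
    rw [← this, Nat.add_sub_cancel_left, inv_pow]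
    field_simp
    ring
  have hS' : ∀ k ≤ d, a (d - k) = cS / Complex.I ^ d * a k := by
    rw [matAct, map_binarySum, C_mul_binarySum] at hS
    simp only [Px, Py, bind₁_X_right] at hS
    simp only [of_apply, cons_val', cons_val_zero, cons_val_one, cons_val_fin_one, map_zero, zero_mul,
      zero_add, add_zero] at hS
    rw [binarySum_C_mul, binarySum_swap] at hS
    intro k hk
    have := binarySum_injective hS k hk
    simp only [Nat.sub_sub_self hk, ← pow_add, Nat.sub_add_cancel hk] at this
    rw [div_mul_eq_mul_div, eq_div_iff (pow_ne_zero _ Complex.I_ne_zero), ← this, mul_comm]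
  have hex : ∃ k, k ≤ d ∧ a k ≠ 0 := by
    by_contra! h0
    exact hf0 (by rw [binarySum_congr h0]; simp [binarySum])
  classical
  obtain ⟨γ, ⟨hγd, haγ⟩, hmin⟩ : ∃ γ, (γ ≤ d ∧ a γ ≠ 0) ∧ ∀ k ≤ d, a k ≠ 0 → γ ≤ k :=
    ⟨Nat.find hex, Nat.find_spec hex, fun k hk hak => Nat.find_min' hex ⟨hk, hak⟩⟩
  have hσ : cS / Complex.I ^ d ≠ 0 := div_ne_zero hcS (pow_ne_zero _ Complex.I_ne_zero)
  have hrefl : ∀ k ≤ d, a k ≠ 0 → a (d - k) ≠ 0 := fun k hk hak => by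
    rw [hS' k hk]; exact mul_ne_zero hσ hak
  have hdvd : ∀ k ≤ d, a k ≠ 0 → n ∣ k - γ := by
    intro k hk hak
    obtain ⟨i, rfl⟩ := Nat.exists_eq_add_of_le (hmin k hk hak)
    have h1 := (hD' _ hk hak).trans (hD' _ hγd haγ).symm
    rw [Nat.mul_add, pow_add] at h1
    have h2 := (hε.pow_eq_one_iff_dvd _).mp
      (mul_left_cancel₀ (pow_ne_zero (2 * γ) hε0) (h1.trans (mul_one _).symm))
    rw [Nat.add_sub_cancel_left]
    exact Nat.dvd_of_mul_dvd_mul_left two_pos h2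
  obtain ⟨m, hm⟩ := hdvd (d - γ) (Nat.sub_le _ _) (hrefl γ hγd haγ)
  have hle := hmin (d - γ) (Nat.sub_le _ _) (hrefl γ hγd haγ)
  have hdm : d = γ + n * m + γ := by omega
  refine ⟨γ, m, fun j => a (γ + n * j), cS / Complex.I ^ d, fun j hj => ?_, ?_⟩
  · obtain ⟨i, rfl⟩ := Nat.exists_eq_add_of_le hj
    rw [Nat.mul_add] at hdm
    rw [← hS' (γ + n * j) (by omega), Nat.add_sub_cancel_left,
      show d - (γ + n * j) = γ + n * i by omega]
  · rw [mul_pow, ← binarySum_of_support hn γ m γ a _ Px Py, ← hdm]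
    intro k hk hak
    rw [← hdm] at hk
    obtain ⟨j, hj⟩ := hdvd k hk hak
    have h1 := hmin k hk hak
    have h2 := hmin _ (Nat.sub_le _ _) (hrefl k hk hak)
    have h3 : n * j ≤ n * m := by omega
    exact ⟨j, Nat.le_of_mul_le_mul_left h3 hn, by omega⟩

lemma matAct_mul (A B : Matrix (Fin 2) (Fin 2) ℂ) (f : BPoly) :
    matAct (A * B) f = matAct B (matAct A f) := by
  unfold matAct
  rw [bind₁_bind₁]
  congr 2
  funext i
  simp [Matrix.mul_apply, Fin.sum_univ_two, Px, Py]
  ring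

lemma matAct_one (f : BPoly) : matAct 1 f = f := by
  have : (fun i => C ((1 : Matrix (Fin 2) (Fin 2) ℂ) i 0) * Px +
      C ((1 : Matrix (Fin 2) (Fin 2) ℂ) i 1) * Py) = X := by
    refine funext (Fin.forall_fin_two.mpr ⟨?_, ?_⟩) <;> simp [Px, Py]
  rw [matAct, this]
  simp

namespace SemiInv

variable {A B : Matrix (Fin 2) (Fin 2) ℂ} {f g : BPoly}

lemma matAct_C_mul (A : Matrix (Fin 2) (Fin 2) ℂ) (c : ℂ) (f : BPoly) :
    matAct A (C c * f) = C c * matAct A f := by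
  simp [matAct]

lemma comp_mul (hA : SemiInv A f) (hB : SemiInv B f) : SemiInv (A * B) f := by
  obtain ⟨c, hc, hA⟩ := hA
  obtain ⟨c', hc', hB⟩ := hB
  exact ⟨c * c', mul_ne_zero hc hc', by rw [matAct_mul, hA, matAct_C_mul, hB, C_mul, mul_assoc]⟩

lemma of_mul_eq_one (hA : SemiInv A f) (h : A * B = 1) : SemiInv B f := by
  obtain ⟨c, hc, hA⟩ := hA
  refine ⟨c⁻¹, inv_ne_zero hc, ?_⟩
  have h1 : C c * matAct B f = f := by rw [← matAct_C_mul, ← hA, ← matAct_mul, h, matAct_one]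
  nth_rw 2 [← h1]
  rw [← mul_assoc, ← C_mul, inv_mul_cancel₀ hc, C_1, one_mul]

lemma const (A : Matrix (Fin 2) (Fin 2) ℂ) (c : ℂ) : SemiInv A (C c) :=
  ⟨1, one_ne_zero, by simp [matAct]⟩

lemma mul (hf : SemiInv A f) (hg : SemiInv A g) : SemiInv A (f * g) := by
  obtain ⟨c, hc, hf⟩ := hf
  obtain ⟨c', hc', hg⟩ := hg
  refine ⟨c * c', mul_ne_zero hc hc', ?_⟩
  rw [show matAct A (f * g) = matAct A f * matAct A g from map_mul _ _ _, hf, hg, C_mul]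
  ring

lemma pow (hf : SemiInv A f) (k : ℕ) : SemiInv A (f ^ k) := by
  induction k with
  | zero => simpa using const A 1
  | succ k ih => rw [pow_succ]; exact ih.mul hf

lemma prod {ι : Type*} (s : Finset ι) {F : ι → BPoly} (h : ∀ i ∈ s, SemiInv A (F i)) :
    SemiInv A (∏ i ∈ s, F i) :=
  Finset.prod_induction F (SemiInv A) (fun _ _ => mul) (by simpa using const A 1) h

lemma of_mem_closure {T : Set (SpecialLinearGroup (Fin 2) ℂ)}
    (hT : ∀ A ∈ T, SemiInv (A : Matrix (Fin 2) (Fin 2) ℂ) f)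
    {A : SpecialLinearGroup (Fin 2) ℂ} (hA : A ∈ Subgroup.closure T) :
    SemiInv (A : Matrix (Fin 2) (Fin 2) ℂ) f := by
  induction hA using Subgroup.closure_induction with
  | mem A hA => exact hT A hA
  | one => exact ⟨1, one_ne_zero, by simp [matAct_one]⟩
  | mul A B _ _ hA hB => simpa using hA.comp_mul hB
  | inv A _ hA =>
    exact hA.of_mul_eq_one (congrArg Subtype.val (mul_inv_cancel A))

/-- If `F₁`, `F₂` are multiplied by scalars with equal squares, every product of the shape in
Klein's theorem is semi-invariant. -/
lemma groundProduct {F₁ F₂ F₃ : BPoly} {c₁ c₂ : ℂ} (hc₁ : c₁ ≠ 0) (hsq : c₂ ^ 2 = c₁ ^ 2)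
    (h₁ : matAct A F₁ = C c₁ * F₁) (h₂ : matAct A F₂ = C c₂ * F₂) (h₃ : SemiInv A F₃)
    (c : ℂ) (α β γ N : ℕ) (lam mu : Fin N → ℂ) :
    SemiInv A (C c * (F₁ ^ α * F₂ ^ β * F₃ ^ γ *
      ∏ i, (C (lam i) * F₁ ^ 2 + C (mu i) * F₂ ^ 2))) := by
  have hc₂ : c₂ ≠ 0 := by
    rintro rfl
    exact hc₁ (pow_eq_zero_iff two_ne_zero |>.mp (by simpa using hsq.symm))
  have hF₁ : SemiInv A F₁ := ⟨c₁, hc₁, h₁⟩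
  have hF₂ : SemiInv A F₂ := ⟨c₂, hc₂, h₂⟩
  refine (const A c).mul ((((hF₁.pow α).mul (hF₂.pow β)).mul (h₃.pow γ)).mul
    (prod _ fun i _ => ⟨c₁ ^ 2, pow_ne_zero 2 hc₁, ?_⟩))
  have hsq' : (C c₂ : BPoly) ^ 2 = C c₁ ^ 2 := by rw [← C_pow, hsq, C_pow]
  unfold matAct at h₁ h₂ ⊢
  simp only [map_add, map_mul, map_pow, h₁, h₂, bind₁_C_right]
  linear_combination C (mu i) * F₂ ^ 2 * hsq'

end SemiInv

/-- Klein's classification of semi-invariants of the binary dihedral group `Dₙ`,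
generated by `diag(ε, ε⁻¹)` (`ε` a primitive `2n`-th root of unity) and
`[[0,i],[i,0]]`: a nonzero binary form is semi-invariant under every element of
`Dₙ` iff it is a nonzero scalar multiple of
`F₁^α F₂^β F₃^γ ∏ᵢ (λᵢ F₁² + μᵢ F₂²)`, where `F₁ = xⁿ+yⁿ`, `F₂ = xⁿ-yⁿ`,
`F₃ = xy` are the ground forms. -/
theorem semiInv_dihedral_iff
    (n : ℕ) (hn : 0 < n) (ε : ℂ) (hε : IsPrimitiveRoot ε (2 * n))
    (D S : SpecialLinearGroup (Fin 2) ℂ)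
    (hD : (D : Matrix (Fin 2) (Fin 2) ℂ) = !![ε, 0; 0, ε⁻¹])
    (hS : (S : Matrix (Fin 2) (Fin 2) ℂ) = !![0, Complex.I; Complex.I, 0])
    (f : BPoly) (hbf : IsBinaryForm f) :
    (∀ A : SpecialLinearGroup (Fin 2) ℂ, A ∈ Subgroup.closure {D, S} →
        SemiInv (A : Matrix (Fin 2) (Fin 2) ℂ) f) ↔
      ∃ c : ℂ, c ≠ 0 ∧ ∃ (α β γ N : ℕ) (lam mu : Fin N → ℂ),
        (∀ i, (lam i, mu i) ≠ (0, 0)) ∧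
        f = C c * ((Px ^ n + Py ^ n) ^ α * (Px ^ n - Py ^ n) ^ β * (Px * Py) ^ γ *
          ∏ i : Fin N,
            (C (lam i) * (Px ^ n + Py ^ n) ^ 2 + C (mu i) * (Px ^ n - Py ^ n) ^ 2)) := by
  constructor
  · intro h
    have hfD := h D (Subgroup.subset_closure (by simp))
    have hfS := h S (Subgroup.subset_closure (by simp))
    rw [hD] at hfD
    rw [hS] at hfS
    obtain ⟨γ, m, b, σ, hb, hf⟩ := exists_eq_of_semiInv hn hε hbf hfD hfS
    have hne : binarySum m b (Px ^ n) (Py ^ n) ≠ 0 := right_ne_zero_of_mul (hf ▸ hbf.1)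
    obtain ⟨c, hc, α, β, N, lam, mu, hlm, hprod⟩ := exists_binarySum_eq_of_symm hb hne
    refine ⟨c, hc, α, β, γ, N, lam, mu, hlm, ?_⟩
    rw [hf, hprod]
    ring
  · rintro ⟨c, -, α, β, γ, N, lam, mu, -, rfl⟩ A hA
    have hεn : ε ^ n = -1 := by
      have h1 : (ε ^ n - 1) * (ε ^ n + 1) = 0 := by
        have := hε.pow_eq_one
        rw [mul_comm, pow_mul] at this
        linear_combination this
      rcases mul_eq_zero.mp h1 with h2 | h2
      · exact absurd (sub_eq_zero.mp h2) (hε.pow_ne_one_of_pos_of_lt (by omega) (by omega))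
      · exact eq_neg_of_add_eq_zero_left h2
    have hε0 : ε ≠ 0 := hε.ne_zero (by omega)
    have hCε : (C ε : BPoly) ^ n = -1 := by rw [← C_pow, hεn]; simp
    have hCεi : (C ε⁻¹ : BPoly) ^ n = -1 := by rw [← C_pow, inv_pow, hεn]; norm_num
    refine SemiInv.of_mem_closure ?_ hA
    rintro B (rfl | rfl)
    · rw [hD]
      refine SemiInv.groundProduct (c₁ := -1) (c₂ := -1) (by simp) rfl ?_ ?_
        ⟨1, one_ne_zero, ?_⟩ ..
      · simp [matAct, Px, Py, mul_pow, hCε, hCεi]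
        ring
      · simp [matAct, Px, Py, mul_pow, hCε, hCεi]
        ring
      · have : (C ε : BPoly) * C ε⁻¹ = 1 := by rw [← C_mul, mul_inv_cancel₀ hε0, C_1]
        simp [matAct, Px, Py]
        linear_combination X 0 * X 1 * this
    · rw [hS]
      refine SemiInv.groundProduct (c₁ := Complex.I ^ n) (c₂ := -Complex.I ^ n)
        (pow_ne_zero n Complex.I_ne_zero) (by ring) ?_ ?_ ⟨-1, by simp, ?_⟩ ..
      · simp [matAct, Px, Py, mul_pow]
        ring
      · simp [matAct, Px, Py, mul_pow]
        ring
      · have : (C Complex.I : BPoly) * C Complex.I = -1 := by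
          rw [← C_mul, Complex.I_mul_I]; simp
        simp [matAct, Px, Py]
        linear_combination X 0 * X 1 * this

end
end

section
/- Let ε ∈ ℂ be a primitive 5th root of unity and let I ⊂ SL(2,ℂ) be the binary icosahedral group generated by diag(ε³, ε²) and (1/√5)[[ε−ε⁴, ε³−ε²],[ε³−ε², ε⁴−ε]], and set F₁ = xy(x¹⁰ + 11x⁵y⁵ − y¹⁰), F₂ = −(x²⁰+y²⁰) + 228(x¹⁵y⁵ − x⁵y¹⁵) − 494x¹⁰y¹⁰, F₃ = (x³⁰+y³⁰) + 522(x²⁵y⁵ − x⁵y²⁵) − 10005(x²⁰y¹⁰ + x¹⁰y²⁰). A nonzero binary form f ∈ ℂ[x,y] is semi-invariant under every element of I if and only if f is a nonzero scalar multiple of F₁^α F₂^β F₃^γ ∏_{i=1}^N (λ_i F₁⁵ + μ_i F₂³) for some nonnegative integers α, β, γ, N and pairs (λ_i, μ_i) ∈ ℂ² \ {(0,0)}. -/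
open MvPolynomial Matrix

noncomputable section

section Identities

variable {R : Type*} [CommRing R]

/-- Klein's form of degree 12, vanishing at the vertices of the icosahedron. -/
def vertexForm (x y : R) : R := x * y * (x ^ 10 + 11 * x ^ 5 * y ^ 5 - y ^ 10)

/-- Klein's form of degree 20, vanishing at the face centres of the icosahedron. -/
def faceForm (x y : R) : R :=
  -(x ^ 20 + y ^ 20) + 228 * (x ^ 15 * y ^ 5 - x ^ 5 * y ^ 15) - 494 * x ^ 10 * y ^ 10

/-- Klein's form of degree 30, vanishing at the edge midpoints of the icosahedron. -/
def edgeForm (x y : R) : R :=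
  (x ^ 30 + y ^ 30) + 522 * (x ^ 25 * y ^ 5 - x ^ 5 * y ^ 25) -
    10005 * (x ^ 20 * y ^ 10 + x ^ 10 * y ^ 20)

theorem vertexForm_eq (x y : R) :
    vertexForm x y = x * y * ((x ^ 10 - y ^ 10) + 11 * (x ^ 5 * y ^ 5)) := by
  unfold vertexForm
  ring

theorem faceForm_eq (x y : R) :
    faceForm x y = -(x ^ 10 - y ^ 10) ^ 2 + 228 * (x ^ 10 - y ^ 10) * (x ^ 5 * y ^ 5) -
      496 * (x ^ 5 * y ^ 5) ^ 2 := by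
  unfold faceForm
  ring

theorem edgeForm_eq (x y : R) :
    edgeForm x y = (x ^ 10 + y ^ 10) * ((x ^ 10 - y ^ 10) ^ 2 +
      522 * (x ^ 10 - y ^ 10) * (x ^ 5 * y ^ 5) - 10004 * (x ^ 5 * y ^ 5) ^ 2) := by
  unfold edgeForm
  ring

theorem map_vertexForm {S F : Type*} [CommRing S] [FunLike F R S] [RingHomClass F R S] (φ : F)
    (x y : R) : φ (vertexForm x y) = vertexForm (φ x) (φ y) := by
  simp [vertexForm, map_ofNat φ]

theorem map_faceForm {S F : Type*} [CommRing S] [FunLike F R S] [RingHomClass F R S] (φ : F)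
    (x y : R) : φ (faceForm x y) = faceForm (φ x) (φ y) := by
  simp [faceForm, map_ofNat φ]

theorem map_edgeForm {S F : Type*} [CommRing S] [FunLike F R S] [RingHomClass F R S] (φ : F)
    (x y : R) : φ (edgeForm x y) = edgeForm (φ x) (φ y) := by
  simp [edgeForm, map_ofNat φ]

theorem vertexForm_rotation {e : R} (he : e ^ 5 = 1) (x y : R) :
    vertexForm (e ^ 3 * x) (e ^ 2 * y) = vertexForm x y := by
  have h3 : (e ^ 3 * x) ^ 5 = x ^ 5 := by rw [mul_pow, pow_right_comm, he, one_pow, one_mul]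
  have h2 : (e ^ 2 * y) ^ 5 = y ^ 5 := by rw [mul_pow, pow_right_comm, he, one_pow, one_mul]
  rw [vertexForm_eq, vertexForm_eq, pow_mul _ 5 2, pow_mul _ 5 2, pow_mul _ 5 2, pow_mul _ 5 2,
    h3, h2, show e ^ 3 * x * (e ^ 2 * y) = e ^ 5 * (x * y) by ring, he, one_mul]

theorem faceForm_rotation {e : R} (he : e ^ 5 = 1) (x y : R) :
    faceForm (e ^ 3 * x) (e ^ 2 * y) = faceForm x y := by
  have h3 : (e ^ 3 * x) ^ 5 = x ^ 5 := by rw [mul_pow, pow_right_comm, he, one_pow, one_mul]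
  have h2 : (e ^ 2 * y) ^ 5 = y ^ 5 := by rw [mul_pow, pow_right_comm, he, one_pow, one_mul]
  rw [faceForm_eq, faceForm_eq, pow_mul _ 5 2, pow_mul _ 5 2, pow_mul _ 5 2, pow_mul _ 5 2,
    h3, h2]

theorem edgeForm_rotation {e : R} (he : e ^ 5 = 1) (x y : R) :
    edgeForm (e ^ 3 * x) (e ^ 2 * y) = edgeForm x y := by
  have h3 : (e ^ 3 * x) ^ 5 = x ^ 5 := by rw [mul_pow, pow_right_comm, he, one_pow, one_mul]
  have h2 : (e ^ 2 * y) ^ 5 = y ^ 5 := by rw [mul_pow, pow_right_comm, he, one_pow, one_mul]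
  rw [edgeForm_eq, edgeForm_eq, pow_mul _ 5 2, pow_mul _ 5 2, pow_mul _ 5 2, pow_mul _ 5 2,
    h3, h2]

theorem vertexForm_smul (a x y : R) : vertexForm (a * x) (a * y) = a ^ 12 * vertexForm x y := by
  unfold vertexForm
  ring

theorem faceForm_smul (a x y : R) : faceForm (a * x) (a * y) = a ^ 20 * faceForm x y := by
  unfold faceForm
  ring

theorem edgeForm_smul (a x y : R) : edgeForm (a * x) (a * y) = a ^ 30 * edgeForm x y := by
  unfold edgeForm
  ring

variable {t : R} (ht : t ^ 2 = t + 1) (x y : R)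
include ht

theorem golden_add_pow_five :
    (x + t * y) ^ 5 = x ^ 5 + 10 * x ^ 3 * y ^ 2 + 10 * x ^ 2 * y ^ 3 + 10 * x * y ^ 4 + 3 * y ^ 5
      +
      t * (5 * x ^ 4 * y + 10 * x ^ 3 * y ^ 2 + 20 * x ^ 2 * y ^ 3 + 15 * x * y ^ 4 +
        5 * y ^ 5) := by
  linear_combination (10 * x ^ 3 * y ^ 2 + 10 * x ^ 2 * y ^ 3 * (t + 1) +
    5 * x * y ^ 4 * (t ^ 2 + t + 2) + y ^ 5 * (t ^ 3 + t ^ 2 + 2 * t + 3)) * ht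

theorem golden_sub_pow_five :
    (t * x - y) ^ 5 = 3 * x ^ 5 - 10 * x ^ 4 * y + 10 * x ^ 3 * y ^ 2 - 10 * x ^ 2 * y ^ 3 - y ^ 5
      +
      t * (5 * x ^ 5 - 15 * x ^ 4 * y + 20 * x ^ 3 * y ^ 2 - 10 * x ^ 2 * y ^ 3 +
        5 * x * y ^ 4) := by
  linear_combination (10 * x ^ 2 * (-y) ^ 3 + 10 * x ^ 3 * y ^ 2 * (t + 1) +
    5 * x ^ 4 * (-y) * (t ^ 2 + t + 2) + x ^ 5 * (t ^ 3 + t ^ 2 + 2 * t + 3)) * ht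

theorem golden_pow_five : t ^ 5 = 3 + 5 * t := by
  linear_combination (t ^ 3 + t ^ 2 + 2 * t + 3) * ht

theorem golden_two_add_sq : (2 + t) ^ 2 = 5 * t ^ 2 := by
  linear_combination (-4) * ht

theorem golden_mul :
    (x + t * y) * (t * x - y) = t * (x ^ 2 + x * y - y ^ 2) := by
  linear_combination x * y * ht

theorem golden_pow_five_mul :
    (x + t * y) ^ 5 * (t * x - y) ^ 5 = t ^ 5 *
      (x ^ 10 + 5 * x ^ 9 * y + 5 * x ^ 8 * y ^ 2 - 10 * x ^ 7 * y ^ 3 - 15 * x ^ 6 * y ^ 4 +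
        11 * x ^ 5 * y ^ 5 + 15 * x ^ 4 * y ^ 6 - 10 * x ^ 3 * y ^ 7 - 5 * x ^ 2 * y ^ 8 +
        5 * x * y ^ 9 - y ^ 10) := by
  rw [golden_add_pow_five ht, golden_sub_pow_five ht, golden_pow_five ht]
  linear_combination (5 * x ^ 4 * y + 10 * x ^ 3 * y ^ 2 + 20 * x ^ 2 * y ^ 3 + 15 * x * y ^ 4 +
    5 * y ^ 5) *
    (5 * x ^ 5 - 15 * x ^ 4 * y + 20 * x ^ 3 * y ^ 2 - 10 * x ^ 2 * y ^ 3 + 5 * x * y ^ 4) * ht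

theorem golden_pow_ten_sub :
    (x + t * y) ^ 10 - (t * x - y) ^ 10 = t ^ 5 *
      (-11 * x ^ 10 + 70 * x ^ 9 * y - 180 * x ^ 8 * y ^ 2 + 360 * x ^ 7 * y ^ 3 -
        210 * x ^ 6 * y ^ 4 + 504 * x ^ 5 * y ^ 5 + 210 * x ^ 4 * y ^ 6 + 360 * x ^ 3 * y ^ 7 +
        180 * x ^ 2 * y ^ 8 + 70 * x * y ^ 9 + 11 * y ^ 10) := by
  rw [show (x + t * y) ^ 10 = ((x + t * y) ^ 5) ^ 2 by ring,
    show (t * x - y) ^ 10 = ((t * x - y) ^ 5) ^ 2 by ring, golden_add_pow_five ht,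
    golden_sub_pow_five ht, golden_pow_five ht]
  linear_combination ((5 * x ^ 4 * y + 10 * x ^ 3 * y ^ 2 + 20 * x ^ 2 * y ^ 3 + 15 * x * y ^ 4 +
    5 * y ^ 5) ^ 2 -
    (5 * x ^ 5 - 15 * x ^ 4 * y + 20 * x ^ 3 * y ^ 2 - 10 * x ^ 2 * y ^ 3 +
      5 * x * y ^ 4) ^ 2) * ht

theorem golden_pow_ten_add :
    (x + t * y) ^ 10 + (t * x - y) ^ 10 = 5 * (2 + t) * t ^ 4 *
      (x ^ 10 - 6 * x ^ 9 * y + 18 * x ^ 8 * y ^ 2 - 24 * x ^ 7 * y ^ 3 + 42 * x ^ 6 * y ^ 4 +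
        42 * x ^ 4 * y ^ 6 + 24 * x ^ 3 * y ^ 7 + 18 * x ^ 2 * y ^ 8 + 6 * x * y ^ 9 +
        y ^ 10) := by
  have h4 : 5 * (2 + t) * t ^ 4 = 35 + 55 * t := by
    linear_combination 5 * (t ^ 3 + 3 * t ^ 2 + 4 * t + 7) * ht
  rw [show (x + t * y) ^ 10 = ((x + t * y) ^ 5) ^ 2 by ring,
    show (t * x - y) ^ 10 = ((t * x - y) ^ 5) ^ 2 by ring, golden_add_pow_five ht,
    golden_sub_pow_five ht, h4]
  linear_combination ((5 * x ^ 4 * y + 10 * x ^ 3 * y ^ 2 + 20 * x ^ 2 * y ^ 3 + 15 * x * y ^ 4 +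
    5 * y ^ 5) ^ 2 +
    (5 * x ^ 5 - 15 * x ^ 4 * y + 20 * x ^ 3 * y ^ 2 - 10 * x ^ 2 * y ^ 3 +
      5 * x * y ^ 4) ^ 2) * ht

theorem vertexForm_golden :
    vertexForm (x + t * y) (t * x - y) = (2 + t) ^ 6 * vertexForm x y := by
  rw [vertexForm_eq (x + t * y), golden_pow_ten_sub ht, golden_pow_five_mul ht, golden_mul ht,
    show (2 + t) ^ 6 = ((2 + t) ^ 2) ^ 3 by ring, golden_two_add_sq ht]
  unfold vertexForm
  ring

theorem faceForm_golden :
    faceForm (x + t * y) (t * x - y) = (2 + t) ^ 10 * faceForm x y := by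
  rw [faceForm_eq (x + t * y), golden_pow_ten_sub ht, mul_assoc 228, mul_assoc (t ^ 5),
    golden_pow_five_mul ht, show (2 + t) ^ 10 = ((2 + t) ^ 2) ^ 5 by ring,
    golden_two_add_sq ht]
  unfold faceForm
  ring

theorem edgeForm_golden :
    edgeForm (x + t * y) (t * x - y) = -(2 + t) ^ 15 * edgeForm x y := by
  rw [edgeForm_eq (x + t * y), golden_pow_ten_sub ht, golden_pow_ten_add ht, mul_assoc 522,
    golden_pow_five_mul ht, show (2 + t) ^ 15 = ((2 + t) ^ 2) ^ 7 * (2 + t) by ring,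
    golden_two_add_sq ht]
  unfold edgeForm
  ring

variable {a : R} (ha : a ^ 2 * (2 + t) = -1)
include ha

theorem vertexForm_invariant :
    vertexForm (a * (x + t * y)) (a * (t * x - y)) = vertexForm x y := by
  rw [vertexForm_smul, vertexForm_golden ht,
    show a ^ 12 * ((2 + t) ^ 6 * vertexForm x y) = (a ^ 2 * (2 + t)) ^ 6 * vertexForm x y by ring,
    ha]
  ring

theorem faceForm_invariant :
    faceForm (a * (x + t * y)) (a * (t * x - y)) = faceForm x y := by
  rw [faceForm_smul, faceForm_golden ht,
    show a ^ 20 * ((2 + t) ^ 10 * faceForm x y) = (a ^ 2 * (2 + t)) ^ 10 * faceForm x y by ring,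
    ha]
  ring

theorem edgeForm_invariant :
    edgeForm (a * (x + t * y)) (a * (t * x - y)) = edgeForm x y := by
  rw [edgeForm_smul, edgeForm_golden ht,
    show a ^ 30 * (-(2 + t) ^ 15 * edgeForm x y) = -(a ^ 2 * (2 + t)) ^ 15 * edgeForm x y by ring,
    ha]
  ring

end Identities

section Action

/-- The substitution action of a matrix, as an algebra homomorphism. -/
def matActHom (A : Matrix (Fin 2) (Fin 2) ℂ) : BPoly →ₐ[ℂ] BPoly :=
  bind₁ fun i ↦ C (A i 0) * Px + C (A i 1) * Py

theorem matAct_eq_matActHom (A : Matrix (Fin 2) (Fin 2) ℂ) (f : BPoly) :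
    matAct A f = matActHom A f := rfl

theorem matActHom_C (A : Matrix (Fin 2) (Fin 2) ℂ) (c : ℂ) : matActHom A (C c) = C c := by
  simp [matActHom]

theorem matActHom_Px (A : Matrix (Fin 2) (Fin 2) ℂ) :
    matActHom A Px = C (A 0 0) * Px + C (A 0 1) * Py := by
  simp [matActHom, Px]

theorem matActHom_Py (A : Matrix (Fin 2) (Fin 2) ℂ) :
    matActHom A Py = C (A 1 0) * Px + C (A 1 1) * Py := by
  simp [matActHom, Py]

theorem matActHom_matActHom (A B : Matrix (Fin 2) (Fin 2) ℂ) (f : BPoly) :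
    matActHom A (matActHom B f) = matActHom (B * A) f := by
  suffices h : (matActHom A).comp (matActHom B) = matActHom (B * A) from DFunLike.congr_fun h f
  ext1 i
  have h : ∀ D : Matrix (Fin 2) (Fin 2) ℂ,
      matActHom D (X i) = C (D i 0) * Px + C (D i 1) * Py := fun D ↦ by simp [matActHom]
  simp only [AlgHom.comp_apply, h, map_add, map_mul, matActHom_C, matActHom_Px, matActHom_Py,
    Matrix.mul_apply, Fin.sum_univ_two]
  ring

theorem matActHom_one (f : BPoly) : matActHom 1 f = f := by
  suffices h : matActHom 1 = AlgHom.id ℂ BPoly from DFunLike.congr_fun h f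
  ext1 i
  fin_cases i <;> simp [matActHom, Px, Py]

theorem eval_matActHom (A : Matrix (Fin 2) (Fin 2) ℂ) (p q : ℂ) (f : BPoly) :
    eval ![p, q] (matActHom A f) = eval ![A 0 0 * p + A 0 1 * q, A 1 0 * p + A 1 1 * q] f := by
  suffices h : (aeval (R := ℂ) ![p, q]).comp (matActHom A) =
      aeval ![A 0 0 * p + A 0 1 * q, A 1 0 * p + A 1 1 * q] from
    DFunLike.congr_fun h f
  ext1 i
  fin_cases i <;> simp [matActHom, Px, Py]

theorem monomial_fin_two (n : Fin 2 →₀ ℕ) (c : ℂ) :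
    (monomial n c : BPoly) = C c * (Px ^ n 0 * Py ^ n 1) := by
  rw [monomial_eq, Finsupp.prod_fintype _ _ fun _ ↦ pow_zero _, Fin.prod_univ_two]
  rfl

theorem coeff_matActHom_diag (p q : ℂ) (m : Fin 2 →₀ ℕ) (f : BPoly) :
    coeff m (matActHom !![p, 0; 0, q] f) = p ^ m 0 * q ^ m 1 * coeff m f := by
  induction f using MvPolynomial.induction_on' with
  | monomial n c =>
    have : matActHom !![p, 0; 0, q] (monomial n c) = monomial n (p ^ n 0 * q ^ n 1 * c) := by
      rw [monomial_fin_two, monomial_fin_two, map_mul, map_mul, map_pow, map_pow, matActHom_C,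
        matActHom_Px, matActHom_Py]
      simp only [Matrix.of_apply, Matrix.cons_val', Matrix.cons_val_zero, Matrix.cons_val_one,
        Matrix.cons_val_fin_one, map_zero, zero_mul, add_zero, zero_add, mul_pow, map_mul, map_pow]
      ring
    rw [this, coeff_monomial, coeff_monomial]
    split_ifs with h
    · rw [h]
    · simp
  | add f g hf hg => rw [map_add, coeff_add, hf, hg, coeff_add]; ring

theorem degree_fin_two (m : Fin 2 →₀ ℕ) : m.degree = m 0 + m 1 := by
  rw [Finsupp.degree_eq_sum, Fin.sum_univ_two]

theorem MvPolynomial.IsHomogeneous.matActHom_scalar {f : BPoly} {d : ℕ} (hf : f.IsHomogeneous d)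
    (p : ℂ) : matActHom !![p, 0; 0, p] f = C (p ^ d) * f := by
  ext m
  rw [coeff_matActHom_diag, coeff_C_mul, ← pow_add, ← degree_fin_two]
  by_cases h : m.degree = d
  · rw [h]
  · rw [hf.coeff_eq_zero h, mul_zero, mul_zero]

theorem MvPolynomial.IsHomogeneous.eval_eq_sum_range {f : BPoly} {d : ℕ}
    (hf : f.IsHomogeneous d) (p q : ℂ) :
    eval ![p, q] f = ∑ k ∈ Finset.range (d + 1),
      coeff (Finsupp.single 0 k + Finsupp.single 1 (d - k)) f * (p ^ k * q ^ (d - k)) := by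
  rw [eval_eq']
  have hm : ∀ m : Fin 2 →₀ ℕ, coeff m f ≠ 0 → m 0 + m 1 = d := fun m h ↦ by
    rw [← degree_fin_two]
    exact not_imp_comm.1 hf.coeff_eq_zero h
  have hs : ∀ m : Fin 2 →₀ ℕ, m 0 + m 1 = d →
      Finsupp.single 0 (m 0) + Finsupp.single 1 (d - m 0) = m := fun m h ↦ by
    ext i
    fin_cases i
    · simp
    · simp
      omega
  refine Finset.sum_of_injOn (fun m ↦ m 0) ?_ ?_ ?_ ?_
  · intro m h n h' he
    rw [Finset.mem_coe, mem_support_iff] at h h'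
    rw [← hs m (hm m h), ← hs n (hm n h'), show m 0 = n 0 from he]
  · intro m h
    rw [Finset.mem_coe, mem_support_iff] at h
    have := hm m h
    simp only [Finset.coe_range, Set.mem_Iio]
    omega
  · intro k _ hk'
    by_contra hne
    refine hk' ⟨_, mem_support_iff.2 (left_ne_zero_of_mul hne), ?_⟩
    simp
  · intro m h
    have h1 := hm m (mem_support_iff.1 h)
    rw [hs m h1, Fin.prod_univ_two, show d - m 0 = m 1 by omega]
    rfl

theorem MvPolynomial.IsHomogeneous.of_mul_left {p g : BPoly} {d e : ℕ} (hp : p.IsHomogeneous e)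
    (hp0 : p ≠ 0) (h : (p * g).IsHomogeneous d) (hg : g ≠ 0) :
    e ≤ d ∧ g.IsHomogeneous (d - e) := by
  let := gradedAlgebra (σ := Fin 2) (R := ℂ)
  have key : ∀ n, homogeneousComponent (e + n) (p * g) = p * homogeneousComponent n g := fun n ↦ by
    have := DirectSum.coe_decompose_mul_add_of_left_mem (homogeneousSubmodule (Fin 2) ℂ)
      (i := e) (j := n) (a := p) (b := g) hp
    rw [← decomposition.decompose'_apply, ← decomposition.decompose'_apply]
    exact this
  have hz : ∀ n, e + n ≠ d → homogeneousComponent n g = 0 := fun n hn ↦ by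
    have := key n
    rw [homogeneousComponent_of_mem h, if_neg (by omega)] at this
    simpa [hp0] using this.symm
  have hed : e ≤ d := by
    by_contra hlt
    refine hg ?_
    rw [← sum_homogeneousComponent g]
    exact Finset.sum_eq_zero fun n _ ↦ hz n (by omega)
  refine ⟨hed, ?_⟩
  have : g = homogeneousComponent (d - e) g := by
    conv_lhs => rw [← sum_homogeneousComponent g]
    by_cases hm : d - e ∈ Finset.range (g.totalDegree + 1)
    · exact Finset.sum_eq_single_of_mem _ hm fun n _ hn ↦ hz n (by omega)
    · rw [Finset.sum_eq_zero fun n hn ↦ hz n (by rintro rfl; simp_all),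
        homogeneousComponent_eq_zero]
      rw [Finset.mem_range] at hm
      omega
  rw [this]
  exact homogeneousComponent_isHomogeneous _ _

end Action

section Divisibility

theorem MvPolynomial.IsHomogeneous.eval_one_zero {f : BPoly} {d : ℕ} (hf : f.IsHomogeneous d) :
    eval ![1, 0] f = coeff (Finsupp.single 0 d) f := by
  rw [hf.eval_eq_sum_range, Finset.sum_range_succ, Finset.sum_eq_zero fun k hk ↦ ?_]
  · simp
  · rw [zero_pow (by have := Finset.mem_range.1 hk; omega), mul_zero, mul_zero]

theorem MvPolynomial.IsHomogeneous.Py_dvd {f : BPoly} {d : ℕ} (hf : f.IsHomogeneous d)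
    (h : eval ![1, 0] f = 0) : Py ∣ f := by
  rw [hf.eval_one_zero] at h
  rw [Py, X_dvd_iff_modMonomial_eq_zero]
  ext m
  by_cases hm : Finsupp.single 1 1 ≤ m
  · rw [coeff_modMonomial_of_le _ hm, coeff_zero]
  rw [coeff_modMonomial_of_not_le _ hm, coeff_zero]
  by_cases hd : m.degree = d
  · have h1 : m 1 = 0 := by
      by_contra h1
      exact hm (Finsupp.single_le_iff.2 (Nat.one_le_iff_ne_zero.2 h1))
    rw [degree_fin_two, h1, add_zero] at hd
    have : m = Finsupp.single 0 d := by
      ext i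
      fin_cases i
      · simp [hd]
      · simp [h1]
    rw [this, h]
  · exact hf.coeff_eq_zero hd

theorem isRelPrime_Px_Py : IsRelPrime Px Py :=
  (X_prime (R := ℂ) (i := (0 : Fin 2))).irreducible.isRelPrime_iff_not_dvd.2 fun h ↦ by
    simp [Py, X_dvd_X] at h

theorem C_mul_dvd_iff {c : ℂ} (hc : c ≠ 0) (p q : BPoly) : C c * p ∣ q ↔ p ∣ q :=
  (hc.isUnit.map (C : ℂ →+* BPoly)).mul_left_dvd

theorem dvd_C_mul_iff {c : ℂ} (hc : c ≠ 0) (p q : BPoly) : p ∣ C c * q ↔ p ∣ q :=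
  (hc.isUnit.map (C : ℂ →+* BPoly)).dvd_mul_left

theorem IsRelPrime.linear_combinations {p q : BPoly} (h : IsRelPrime p q) {a b c d : ℂ}
    (hdet : a * d - b * c ≠ 0) :
    IsRelPrime (C a * p + C b * q) (C c * p + C d * q) := by
  intro r h1 h2
  refine h ((dvd_C_mul_iff hdet _ _).1 ?_) ((dvd_C_mul_iff hdet _ _).1 ?_)
  · rw [show C (a * d - b * c) * p =
      (C a * p + C b * q) * C d - (C c * p + C d * q) * C b by simp only [C_sub, C_mul]; ring]
    exact dvd_sub (h1.mul_right _) (h2.mul_right _)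
  · rw [show C (a * d - b * c) * q =
      (C c * p + C d * q) * C a - (C a * p + C b * q) * C c by simp only [C_sub, C_mul]; ring]
    exact dvd_sub (h2.mul_right _) (h1.mul_right _)

theorem pow_five_sub_pow_five_dvd {ε : ℂ} (hε : IsPrimitiveRoot ε 5) {a b : ℂ} (ha : a ≠ 0)
    (hb : b ≠ 0) {f : BPoly} (h : ∀ k : ℕ, C (ε ^ k * a) * Px - C b * Py ∣ f) :
    C (a ^ 5) * Px ^ 5 - C (b ^ 5) * Py ^ 5 ∣ f := by
  have hC : IsPrimitiveRoot (C ε : BPoly) 5 := hε.map_of_injective (C_injective _ _)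
  rw [C_pow, C_pow, ← mul_pow, ← mul_pow, ← neg_sub, neg_dvd,
    hC.pow_sub_pow_eq_prod_sub_mul _ _ (by norm_num)]
  refine Finset.prod_dvd_of_isRelPrime ?_ ?_
  · intro z hz w hw hne
    rw [Finset.mem_coe, Polynomial.mem_nthRootsFinset (by norm_num)] at hz hw
    obtain ⟨i, -, rfl⟩ := hC.eq_pow_of_pow_eq_one hz
    obtain ⟨j, -, rfl⟩ := hC.eq_pow_of_pow_eq_one hw
    have := isRelPrime_Px_Py.linear_combinations (a := -(ε ^ i * a)) (b := b)
      (c := -(ε ^ j * a)) (d := b) (fun h0 ↦ hne ?_)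
    · simp only [C_neg, C_mul, C_pow] at this
      have e : ∀ k : ℕ, C b * Py - C ε ^ k * (C a * Px) = -(C ε ^ k * C a) * Px + C b * Py :=
        fun k ↦ by ring
      rwa [← e, ← e] at this
    · have : (ε ^ j - ε ^ i) * (a * b) = 0 := by linear_combination h0
      rw [← C_pow, ← C_pow, sub_eq_zero.1 ((mul_eq_zero.1 this).resolve_right (mul_ne_zero ha hb))]
  · intro z hz
    rw [Polynomial.mem_nthRootsFinset (by norm_num)] at hz
    obtain ⟨i, -, rfl⟩ := hC.eq_pow_of_pow_eq_one hz
    have := (neg_dvd.2 (h i))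
    convert this using 1
    simp only [C_mul, C_pow]
    ring

end Divisibility

section Invariants

/-- Invariance under the two generators of the binary icosahedral group, the second one being
written in terms of the golden ratio `t`. -/
structure IsIcosahedralInvariant (ε t a : ℂ) (f : BPoly) : Prop where
  rotation : matActHom !![ε ^ 3, 0; 0, ε ^ 2] f = f
  flip : matActHom !![a, a * t; a * t, -a] f = f

namespace IsIcosahedralInvariant

variable {ε t a : ℂ} {f g : BPoly}

theorem const (c : ℂ) : IsIcosahedralInvariant ε t a (C c) :=
  ⟨matActHom_C _ _, matActHom_C _ _⟩

theorem mul (hf : IsIcosahedralInvariant ε t a f) (hg : IsIcosahedralInvariant ε t a g) :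
    IsIcosahedralInvariant ε t a (f * g) :=
  ⟨by rw [map_mul, hf.1, hg.1], by rw [map_mul, hf.2, hg.2]⟩

theorem add (hf : IsIcosahedralInvariant ε t a f) (hg : IsIcosahedralInvariant ε t a g) :
    IsIcosahedralInvariant ε t a (f + g) :=
  ⟨by rw [map_add, hf.1, hg.1], by rw [map_add, hf.2, hg.2]⟩

theorem sub (hf : IsIcosahedralInvariant ε t a f) (hg : IsIcosahedralInvariant ε t a g) :
    IsIcosahedralInvariant ε t a (f - g) :=
  ⟨by rw [map_sub, hf.1, hg.1], by rw [map_sub, hf.2, hg.2]⟩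

theorem pow (hf : IsIcosahedralInvariant ε t a f) (n : ℕ) :
    IsIcosahedralInvariant ε t a (f ^ n) :=
  ⟨by rw [map_pow, hf.1], by rw [map_pow, hf.2]⟩

theorem prod {ι : Type*} (s : Finset ι) {F : ι → BPoly}
    (hF : ∀ i, IsIcosahedralInvariant ε t a (F i)) :
    IsIcosahedralInvariant ε t a (∏ i ∈ s, F i) :=
  ⟨by rw [map_prod]; exact Finset.prod_congr rfl fun i _ ↦ (hF i).1,
    by rw [map_prod]; exact Finset.prod_congr rfl fun i _ ↦ (hF i).2⟩

theorem of_mul_left (hf : IsIcosahedralInvariant ε t a f) (hf0 : f ≠ 0)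
    (h : IsIcosahedralInvariant ε t a (f * g)) : IsIcosahedralInvariant ε t a g := by
  constructor
  · have := h.1
    rw [map_mul, hf.1] at this
    exact mul_left_cancel₀ hf0 this
  · have := h.2
    rw [map_mul, hf.2] at this
    exact mul_left_cancel₀ hf0 this

theorem dvd_rotation (hε : IsPrimitiveRoot ε 5) (hf : IsIcosahedralInvariant ε t a f) {p q : ℂ}
    (h : C p * Px + C q * Py ∣ f) (k : ℕ) : C (ε ^ k * p) * Px + C q * Py ∣ f := by
  induction k with
  | zero => simpa using h
  | succ k ih =>
    have := map_dvd (matActHom !![ε ^ 3, 0; 0, ε ^ 2]) ih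
    rw [hf.1] at this
    refine (C_mul_dvd_iff (pow_ne_zero 2 (hε.ne_zero (by norm_num))) _ _).1 ?_
    convert this using 1
    simp [matActHom_Px, matActHom_Py]
    ring

theorem dvd_flip (ha : a ≠ 0) (hf : IsIcosahedralInvariant ε t a f) {p q : ℂ}
    (h : C p * Px + C q * Py ∣ f) : C (p + q * t) * Px + C (p * t - q) * Py ∣ f := by
  have := map_dvd (matActHom !![a, a * t; a * t, -a]) h
  rw [hf.2] at this
  refine (C_mul_dvd_iff ha _ _).1 ?_
  convert this using 1
  simp [matActHom_Px, matActHom_Py]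
  ring

theorem dvd_mul_const {c : ℂ} (hc : c ≠ 0) {p q : ℂ} (h : C p * Px + C q * Py ∣ f) :
    C (c * p) * Px + C (c * q) * Py ∣ f := by
  refine (C_mul_dvd_iff (inv_ne_zero hc) _ _).1 ?_
  convert h using 1
  rw [mul_add, ← mul_assoc, ← mul_assoc, ← C_mul, ← C_mul, inv_mul_cancel_left₀ hc,
    inv_mul_cancel_left₀ hc]

end IsIcosahedralInvariant

variable {ε t a : ℂ}

theorem matActHom_diag_Px_Py (p q : ℂ) : matActHom !![p, 0; 0, q] Px = C p * Px ∧
    matActHom !![p, 0; 0, q] Py = C q * Py := by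
  simp [matActHom_Px, matActHom_Py]

theorem matActHom_flip_Px_Py : matActHom !![a, a * t; a * t, -a] Px = C a * (Px + C t * Py) ∧
    matActHom !![a, a * t; a * t, -a] Py = C a * (C t * Px - Py) := by
  simp only [matActHom_Px, matActHom_Py]
  constructor <;> simp <;> ring

theorem isIcosahedralInvariant_vertexForm (hε : IsPrimitiveRoot ε 5) (ht : t ^ 2 = t + 1)
    (ha : a ^ 2 * (2 + t) = -1) : IsIcosahedralInvariant ε t a (vertexForm Px Py) := by
  constructor
  · rw [map_vertexForm, (matActHom_diag_Px_Py _ _).1, (matActHom_diag_Px_Py _ _).2, C_pow, C_pow,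
      vertexForm_rotation (by rw [← C_pow, hε.pow_eq_one, C_1])]
  · rw [map_vertexForm, matActHom_flip_Px_Py.1, matActHom_flip_Px_Py.2]
    refine vertexForm_invariant ?_ _ _ ?_
    · rw [← C_pow, ht, C_add, C_1]
    · rw [← C_pow, ← map_ofNat C 2, ← C_add, ← C_mul, ha, C_neg, C_1]

theorem isIcosahedralInvariant_faceForm (hε : IsPrimitiveRoot ε 5) (ht : t ^ 2 = t + 1)
    (ha : a ^ 2 * (2 + t) = -1) : IsIcosahedralInvariant ε t a (faceForm Px Py) := by
  constructor
  · rw [map_faceForm, (matActHom_diag_Px_Py _ _).1, (matActHom_diag_Px_Py _ _).2, C_pow, C_pow,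
      faceForm_rotation (by rw [← C_pow, hε.pow_eq_one, C_1])]
  · rw [map_faceForm, matActHom_flip_Px_Py.1, matActHom_flip_Px_Py.2]
    refine faceForm_invariant ?_ _ _ ?_
    · rw [← C_pow, ht, C_add, C_1]
    · rw [← C_pow, ← map_ofNat C 2, ← C_add, ← C_mul, ha, C_neg, C_1]

theorem isIcosahedralInvariant_edgeForm (hε : IsPrimitiveRoot ε 5) (ht : t ^ 2 = t + 1)
    (ha : a ^ 2 * (2 + t) = -1) : IsIcosahedralInvariant ε t a (edgeForm Px Py) := by
  constructor
  · rw [map_edgeForm, (matActHom_diag_Px_Py _ _).1, (matActHom_diag_Px_Py _ _).2, C_pow, C_pow,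
      edgeForm_rotation (by rw [← C_pow, hε.pow_eq_one, C_1])]
  · rw [map_edgeForm, matActHom_flip_Px_Py.1, matActHom_flip_Px_Py.2]
    refine edgeForm_invariant ?_ _ _ ?_
    · rw [← C_pow, ht, C_add, C_1]
    · rw [← C_pow, ← map_ofNat C 2, ← C_add, ← C_mul, ha, C_neg, C_1]

end Invariants

section VertexFormDvd

variable {ε t a : ℂ}

theorem golden_ne_zero (ht : t ^ 2 = t + 1) : t ≠ 0 := by
  rintro rfl
  norm_num at ht

theorem golden_pow_ten_add_one_ne_zero (ht : t ^ 2 = t + 1) : t ^ 10 + 1 ≠ 0 := by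
  intro h
  rw [pow_mul t 5 2, golden_pow_five ht] at h
  have h0 : (5 : ℂ) ^ 3 = 0 := by
    linear_combination 3025 * ht - 5 * (11 * t - 18) * (h - 25 * ht)
  norm_num at h0

theorem IsPrimitiveRoot.five_sum {ε : ℂ} (hε : IsPrimitiveRoot ε 5) :
    1 + ε + ε ^ 2 + ε ^ 3 + ε ^ 4 = 0 := by
  simpa [Finset.sum_range_succ] using hε.geom_sum_eq_zero (by norm_num)

theorem golden_of_isPrimitiveRoot (hε : IsPrimitiveRoot ε 5) (htε : t = -(ε + ε ^ 4)) :
    t ^ 2 = t + 1 := by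
  subst htε
  linear_combination (ε ^ 3 + 2) * hε.pow_eq_one + hε.five_sum

theorem IsIcosahedralInvariant.vertexForm_dvd {f : BPoly} {d : ℕ} (hε : IsPrimitiveRoot ε 5)
    (htε : t = -(ε + ε ^ 4)) (ha : a ≠ 0) (hf : IsIcosahedralInvariant ε t a f)
    (hd : f.IsHomogeneous d) (h : eval ![1, 0] f = 0) : vertexForm Px Py ∣ f := by
  have ht := golden_of_isPrimitiveRoot hε htε
  have ht0 := golden_ne_zero ht
  have h5 := hε.pow_eq_one
  have hε0 : ε ≠ 0 := hε.ne_zero (by norm_num)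
  have hy := hd.Py_dvd h
  have h1 : C t * Px + C (-1) * Py ∣ f := by
    simpa using hf.dvd_flip ha (p := 0) (q := 1) (by simpa using hy)
  have hR : C (t ^ 5) * Px ^ 5 - C (1 ^ 5) * Py ^ 5 ∣ f :=
    pow_five_sub_pow_five_dvd hε ht0 one_ne_zero fun k ↦ by
      simpa [sub_eq_add_neg] using hf.dvd_rotation hε h1 k
  have h2 : C 1 * Px + C t * Py ∣ f := by
    have hc : ε ^ 3 * (ε ^ 2 - 1) * t ≠ 0 := by
      refine mul_ne_zero (mul_ne_zero (pow_ne_zero _ hε0) (sub_ne_zero.2 ?_)) ht0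
      exact hε.pow_ne_one_of_pos_of_lt (by norm_num) (by norm_num)
    have := dvd_mul_const (inv_ne_zero hc)
      (hf.dvd_rotation hε (hf.dvd_flip ha (hf.dvd_rotation hε h1 2)) 3)
    convert this using 4
    · rw [eq_inv_mul_iff_mul_eq₀ hc]
      ring
    · rw [eq_inv_mul_iff_mul_eq₀ hc]
      have e : t ^ 2 = ε ^ 2 + 2 + ε ^ 3 := by
        rw [htε]
        linear_combination (ε ^ 3 + 2) * h5
      linear_combination (ε ^ 5 - ε ^ 3 - ε ^ 2) * e +
        (ε ^ 3 + ε ^ 2 - ε) * h5 - hε.five_sum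
  have hx : Px ∣ f := by
    have := hf.dvd_flip ha h2
    rwa [show 1 * t - t = 0 by ring, C_0, zero_mul, add_zero, C_mul_dvd_iff] at this
    intro h0
    have h1 : (5 : ℂ) = 0 := by linear_combination (3 - t) * h0 + (t - 2) * ht
    norm_num at h1
  have hS : C (1 ^ 5) * Px ^ 5 - C ((-t) ^ 5) * Py ^ 5 ∣ f :=
    pow_five_sub_pow_five_dvd hε one_ne_zero (neg_ne_zero.2 ht0) fun k ↦ by
      simpa using hf.dvd_rotation hε h2 k
  have hXY : IsRelPrime (Px ^ 5) (Py ^ 5) := isRelPrime_Px_Py.pow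
  have hxR : IsRelPrime Px (C (t ^ 5) * Px ^ 5 - C (1 ^ 5) * Py ^ 5) := by
    have := hXY.linear_combinations (a := 1) (b := 0) (c := t ^ 5) (d := -1) (by norm_num)
    refine IsRelPrime.of_mul_left_left (y := Px ^ 4) ?_
    exact (congrArg₂ IsRelPrime (by simp only [C_1, C_0]; ring) (by simp; ring)).mp this
  have hxS : IsRelPrime Px (C (1 ^ 5) * Px ^ 5 - C ((-t) ^ 5) * Py ^ 5) := by
    have := hXY.linear_combinations (a := 1) (b := 0) (c := 1) (d := t ^ 5) (by simpa using ht0)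
    refine IsRelPrime.of_mul_left_left (y := Px ^ 4) ?_
    exact (congrArg₂ IsRelPrime (by simp only [C_1, C_0]; ring) (by simp; ring)).mp this
  have hyR : IsRelPrime Py (C (t ^ 5) * Px ^ 5 - C (1 ^ 5) * Py ^ 5) := by
    have := hXY.linear_combinations (a := 0) (b := 1) (c := t ^ 5) (d := -1) (by simpa using ht0)
    refine IsRelPrime.of_mul_left_left (y := Py ^ 4) ?_
    exact (congrArg₂ IsRelPrime (by simp only [C_1, C_0]; ring) (by simp; ring)).mp this
  have hyS : IsRelPrime Py (C (1 ^ 5) * Px ^ 5 - C ((-t) ^ 5) * Py ^ 5) := by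
    have := hXY.linear_combinations (a := 0) (b := 1) (c := 1) (d := t ^ 5) (by norm_num)
    refine IsRelPrime.of_mul_left_left (y := Py ^ 4) ?_
    exact (congrArg₂ IsRelPrime (by simp only [C_1, C_0]; ring) (by simp; ring)).mp this
  have hRS : IsRelPrime (C (t ^ 5) * Px ^ 5 - C (1 ^ 5) * Py ^ 5)
      (C (1 ^ 5) * Px ^ 5 - C ((-t) ^ 5) * Py ^ 5) := by
    have := hXY.linear_combinations (a := t ^ 5) (b := -1) (c := 1) (d := t ^ 5) (by
      convert golden_pow_ten_add_one_ne_zero ht using 1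
      ring)
    exact (congrArg₂ IsRelPrime (by simp; ring) (by simp; ring)).mp this
  have key := ((hxS.mul_left hyS).mul_left hRS).mul_dvd
    ((hxR.mul_left hyR).mul_dvd (isRelPrime_Px_Py.mul_dvd hx hy) hR) hS
  refine (C_mul_dvd_iff (pow_ne_zero 5 ht0) _ _).1 ?_
  convert key using 1
  have e : (C t ^ 10 : BPoly) = 11 * C t ^ 5 + 1 := by
    have : t ^ 10 = 11 * t ^ 5 + 1 := by
      rw [pow_mul t 5 2, golden_pow_five ht]
      linear_combination 25 * ht
    rw [← C_pow, this, C_add, C_mul, C_pow, C_1, map_ofNat]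
  simp [vertexForm]
  linear_combination (-1) * Px ^ 6 * Py ^ 6 * e

end VertexFormDvd

section SemiInvariants

variable {ε t a : ℂ} {f : BPoly} {d : ℕ}

theorem C_mul_right_cancel {c e : ℂ} (hf : f ≠ 0) (h : C c * f = C e * f) : c = e :=
  C_injective _ _ (mul_right_cancel₀ hf h)

theorem matActHom_mul_of_eq {A B : Matrix (Fin 2) (Fin 2) ℂ} {c e : ℂ}
    (hA : matActHom A f = C c * f) (hB : matActHom B f = C e * f) :
    matActHom (A * B) f = C (c * e) * f := by
  rw [← matActHom_matActHom, hA, map_mul, matActHom_C, hB, C_mul, mul_assoc]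

theorem even_and_isIcosahedralInvariant (hε : IsPrimitiveRoot ε 5) (htε : t = -(ε + ε ^ 4))
    (ha : a ^ 2 * (2 + t) = -1) (hf : f ≠ 0) (hd : f.IsHomogeneous d) {c₁ c₂ : ℂ}
    (h₁ : matActHom !![ε ^ 3, 0; 0, ε ^ 2] f = C c₁ * f)
    (h₂ : matActHom !![a, a * t; a * t, -a] f = C c₂ * f) :
    Even d ∧ IsIcosahedralInvariant ε t a f := by
  have ht := golden_of_isPrimitiveRoot hε htε
  have hε5 := hε.pow_eq_one
  have hc₁ : c₁ ^ 5 = 1 := by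
    obtain ⟨m, hm⟩ := ne_zero_iff.1 hf
    have := congrArg (coeff m) h₁
    rw [coeff_matActHom_diag, coeff_C_mul] at this
    rw [← mul_right_cancel₀ hm this, ← pow_mul, ← pow_mul, ← pow_add, ← pow_mul, mul_comm, pow_mul,
      hε5, one_pow]
  have hc₂ : c₂ ^ 2 = (-1) ^ d := by
    refine C_mul_right_cancel hf ?_
    rw [sq, ← matActHom_mul_of_eq h₂ h₂, ← hd.matActHom_scalar]
    congr 2
    ext i j
    fin_cases i <;> fin_cases j <;> simp [Matrix.mul_apply, Fin.sum_univ_two]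
    · linear_combination ha + a ^ 2 * ht
    · ring
    · ring
    · linear_combination ha + a ^ 2 * ht
  have hu2 : (a * (ε ^ 3 - ε ^ 2)) ^ 2 = 1 := by
    linear_combination a ^ 2 * (ε - 2) * hε5 - ha + a ^ 2 * htε
  have hc₁₂ : (c₁ * c₂) ^ 3 = (-(a * (ε ^ 3 - ε ^ 2))) ^ d := by
    refine C_mul_right_cancel hf ?_
    have h := matActHom_mul_of_eq h₁ h₂
    rw [pow_succ, sq, ← matActHom_mul_of_eq (matActHom_mul_of_eq h h) h, ← hd.matActHom_scalar]
    congr 2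
    have hdet : a ^ 2 * (1 + t ^ 2) * ε ^ 5 = -1 := by
      linear_combination ha + a ^ 2 * ht + a ^ 2 * (1 + t ^ 2) * hε5
    ext i j
    fin_cases i <;> fin_cases j <;> simp [Matrix.mul_apply, Fin.sum_univ_two]
    · linear_combination a * ε ^ 3 * hu2 + a * (2 * ε ^ 3 - ε ^ 2) * hdet
    · linear_combination a * t * ε ^ 3 * hu2 + a * t * ε ^ 3 * hdet
    · linear_combination a * t * ε ^ 2 * hu2 + a * t * ε ^ 2 * hdet
    · linear_combination (-a * ε ^ 2) * hu2 + a * (ε ^ 3 - 2 * ε ^ 2) * hdet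
  have hc6 : (c₁ * c₂) ^ 6 = 1 := by
    rw [show (c₁ * c₂) ^ 6 = ((c₁ * c₂) ^ 3) ^ 2 by ring, hc₁₂, pow_right_comm,
      neg_sq, hu2, one_pow]
  have hc4 : c₂ ^ 4 = 1 := by
    rw [show c₂ ^ 4 = (c₂ ^ 2) ^ 2 by ring, hc₂, ← pow_mul, mul_comm, pow_mul, neg_one_sq, one_pow]
  have h12 : c₁ * c₂ ^ 2 = 1 := by
    linear_combination hc6 - c₁ * c₂ ^ 6 * hc₁ - c₁ * c₂ ^ 2 * hc4
  have h11 : c₁ ^ 2 = 1 := by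
    linear_combination (c₁ * c₂ ^ 2 + 1) * h12 - c₁ ^ 2 * hc4
  have h1 : c₁ = 1 := by
    linear_combination hc₁ - c₁ * (c₁ ^ 2 + 1) * h11
  have h22 : c₂ ^ 2 = 1 := by rwa [h1, one_mul] at h12
  have heven : Even d := by
    rw [hc₂] at h22
    exact (neg_one_pow_eq_one_iff_even (by norm_num)).1 h22
  have h2 : c₂ = 1 := by
    rw [heven.neg_pow, h1] at hc₁₂
    obtain ⟨k, rfl⟩ := heven
    rw [← two_mul, pow_mul, hu2, one_pow] at hc₁₂
    linear_combination hc₁₂ - c₂ * h22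
  refine ⟨heven, ?_, ?_⟩
  · rw [h₁, h1, C_1, one_mul]
  · rw [h₂, h2, C_1, one_mul]

end SemiInvariants

section Degrees

variable {ε t a : ℂ} {f : BPoly} {d : ℕ}

theorem IsIcosahedralInvariant.dvd_of_coeff_ne_zero (hε : IsPrimitiveRoot ε 5)
    (hf : IsIcosahedralInvariant ε t a f) {m : Fin 2 →₀ ℕ} (hm : coeff m f ≠ 0) :
    5 ∣ 3 * m 0 + 2 * m 1 := by
  have := congrArg (coeff m) hf.rotation
  rw [coeff_matActHom_diag, mul_eq_right₀ hm, ← pow_mul, ← pow_mul, ← pow_add] at this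
  exact hε.dvd_of_pow_eq_one _ this

theorem IsIcosahedralInvariant.eval_degree_ten (hε : IsPrimitiveRoot ε 5)
    (hf : IsIcosahedralInvariant ε t a f) (hd : f.IsHomogeneous 10) :
    ∃ α β γ : ℂ, ∀ p q, eval ![p, q] f = α * p ^ 10 + β * (p ^ 5 * q ^ 5) + γ * q ^ 10 := by
  refine ⟨coeff (Finsupp.single 0 10 + Finsupp.single 1 (10 - 10)) f,
    coeff (Finsupp.single 0 5 + Finsupp.single 1 (10 - 5)) f,
    coeff (Finsupp.single 0 0 + Finsupp.single 1 (10 - 0)) f, fun p q ↦ ?_⟩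
  have h0 : ∀ k ≤ 10, ¬ 5 ∣ k → coeff (Finsupp.single 0 k + Finsupp.single 1 (10 - k)) f = 0 := by
    intro k hk hk5
    by_contra h
    have := hf.dvd_of_coeff_ne_zero hε h
    simp at this
    omega
  rw [hd.eval_eq_sum_range]
  simp only [Finset.sum_range_succ, Finset.sum_range_zero]
  rw [h0 1 (by norm_num) (by norm_num), h0 2 (by norm_num) (by norm_num),
    h0 3 (by norm_num) (by norm_num), h0 4 (by norm_num) (by norm_num),
    h0 6 (by norm_num) (by norm_num), h0 7 (by norm_num) (by norm_num),
    h0 8 (by norm_num) (by norm_num), h0 9 (by norm_num) (by norm_num)]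
  ring

theorem IsIcosahedralInvariant.eval_one_zero_of_degree_ten (hε : IsPrimitiveRoot ε 5)
    (ht : t ^ 2 = t + 1) (ha : a ^ 2 * (2 + t) = -1)
    (hf : IsIcosahedralInvariant ε t a f) (hd : f.IsHomogeneous 10) : eval ![1, 0] f = 0 := by
  obtain ⟨α, β, γ, h⟩ := hf.eval_degree_ten hε hd
  have ha10 : a ^ 10 * (2 + t) ^ 5 = -1 := by
    rw [show a ^ 10 * (2 + t) ^ 5 = (a ^ 2 * (2 + t)) ^ 5 by ring, ha]
    norm_num
  have key : ∀ p q : ℂ, (2 + t) ^ 5 * (α * p ^ 10 + β * (p ^ 5 * q ^ 5) + γ * q ^ 10) =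
      -(α * (p + t * q) ^ 10 + β * ((p + t * q) ^ 5 * (t * p - q) ^ 5) +
        γ * (t * p - q) ^ 10) := by
    intro p q
    have := eval_matActHom !![a, a * t; a * t, -a] p q f
    rw [hf.flip, h] at this
    simp only [of_apply, cons_val', cons_val_zero, cons_val_one, h] at this
    rw [this]
    linear_combination (α * (p + t * q) ^ 10 + β * ((p + t * q) ^ 5 * (t * p - q) ^ 5) +
        γ * (t * p - q) ^ 10) * ha10
  have e2 : (2 + t) ^ 5 = 175 + 275 * t := by
    rw [show (2 + t) ^ 5 = ((2 + t) ^ 2) ^ 2 * (2 + t) by ring, golden_two_add_sq ht, ht]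
    linear_combination (25 * t + 125) * ht
  have e5 := golden_pow_five ht
  have e10 : t ^ 10 = 34 + 55 * t := by
    rw [pow_mul t 5 2, e5]
    linear_combination 25 * ht
  have e1 : (1 + t) ^ 5 = 34 + 55 * t := by
    rw [← e10, add_comm, ← ht]
    ring
  have e3 : (t - 1) ^ 5 = 5 * t - 8 := by
    have := golden_pow_five (t := 1 - t) (by linear_combination ht)
    linear_combination (-1) * this
  have h10 : α * (176 + 275 * t) + β * (3 + 5 * t) + γ * (34 + 55 * t) = 0 := by
    have := key 1 0
    norm_num [e2, e5, e10] at this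
    linear_combination this
  have h01 : α * (34 + 55 * t) - β * (3 + 5 * t) + γ * (176 + 275 * t) = 0 := by
    have := key 0 1
    norm_num [e2, e5, e10] at this
    linear_combination this
  have h11 : α * (4356 + 7040 * t) + β * (178 + 280 * t) + γ * (264 + 220 * t) = 0 := by
    have := key 1 1
    norm_num [e2, pow_mul (1 + t) 5 2, pow_mul (t - 1) 5 2, e1, e3] at this
    linear_combination this - (3025 * α + 275 * β + 25 * γ) * ht
  have hγ : γ = -α := by
    linear_combination (18 - 11 * t) / 150 * (h10 + h01) + 121 / 5 * (α + γ) * ht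
  subst hγ
  have hβ : β = α * (36 - 50 * t) := by
    linear_combination (5 * t - 8) * h10 - (25 * β + 1100 * α) * ht
  subst hβ
  have hα : α = 0 := by
    linear_combination (19 - 12 * t) / 5500 * h11 + α * (388 - 336 * t) / 11 * ht
  simp [h, hα]

theorem IsIcosahedralInvariant.degree_eq (hε : IsPrimitiveRoot ε 5)
    (ht : t ^ 2 = t + 1) (ha : a ^ 2 * (2 + t) = -1)
    (hf : IsIcosahedralInvariant ε t a f) (hd : f.IsHomogeneous d) (heven : Even d)
    (h : eval ![1, 0] f ≠ 0) : ∃ β γ, γ ≤ 1 ∧ d = 20 * β + 30 * γ := by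
  have h10 : d ≠ 10 := by
    rintro rfl
    exact h (hf.eval_one_zero_of_degree_ten hε ht ha hd)
  rw [hd.eval_one_zero] at h
  have h5 := hf.dvd_of_coeff_ne_zero hε h
  simp at h5
  obtain ⟨k, rfl⟩ := heven
  by_cases h4 : 20 ∣ k + k
  · exact ⟨(k + k) / 20, 0, by omega, by omega⟩
  · exact ⟨(k + k - 30) / 20, 1, by omega, by omega⟩

end Degrees

section GroundForms

theorem isHomogeneous_Px : Px.IsHomogeneous 1 := isHomogeneous_X ℂ 0

theorem isHomogeneous_Py : Py.IsHomogeneous 1 := isHomogeneous_X ℂ 1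

theorem isHomogeneous_Px_pow_mul_Py_pow (i j : ℕ) : (Px ^ i * Py ^ j).IsHomogeneous (i + j) := by
  simpa using (isHomogeneous_Px.pow i).mul (isHomogeneous_Py.pow j)

theorem isHomogeneous_vertexForm : (vertexForm Px Py).IsHomogeneous 12 := by
  have h : vertexForm Px Py = Px ^ 11 * Py ^ 1 + C 11 * (Px ^ 6 * Py ^ 6) - Px ^ 1 * Py ^ 11 := by
    rw [vertexForm, map_ofNat C]
    ring
  rw [h]
  exact ((isHomogeneous_Px_pow_mul_Py_pow 11 1).add
    ((isHomogeneous_Px_pow_mul_Py_pow 6 6).C_mul 11)).sub (isHomogeneous_Px_pow_mul_Py_pow 1 11)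

theorem isHomogeneous_faceForm : (faceForm Px Py).IsHomogeneous 20 := by
  have h : faceForm Px Py = C (-1) * (Px ^ 20 * Py ^ 0) + C 228 * (Px ^ 15 * Py ^ 5) -
      C 494 * (Px ^ 10 * Py ^ 10) - C 228 * (Px ^ 5 * Py ^ 15) - Px ^ 0 * Py ^ 20 := by
    rw [faceForm, map_ofNat C, map_ofNat C, C_neg, C_1]
    ring
  rw [h]
  exact (((((isHomogeneous_Px_pow_mul_Py_pow 20 0).C_mul (-1)).add
    ((isHomogeneous_Px_pow_mul_Py_pow 15 5).C_mul 228)).sub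
    ((isHomogeneous_Px_pow_mul_Py_pow 10 10).C_mul 494)).sub
    ((isHomogeneous_Px_pow_mul_Py_pow 5 15).C_mul 228)).sub (isHomogeneous_Px_pow_mul_Py_pow 0 20)

theorem isHomogeneous_edgeForm : (edgeForm Px Py).IsHomogeneous 30 := by
  have h : edgeForm Px Py = Px ^ 30 * Py ^ 0 + C 522 * (Px ^ 25 * Py ^ 5) -
      C 10005 * (Px ^ 20 * Py ^ 10) - C 10005 * (Px ^ 10 * Py ^ 20) - C 522 * (Px ^ 5 * Py ^ 25) +
      Px ^ 0 * Py ^ 30 := by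
    rw [edgeForm, map_ofNat C, map_ofNat C]
    ring
  rw [h]
  exact (((((isHomogeneous_Px_pow_mul_Py_pow 30 0).add
    ((isHomogeneous_Px_pow_mul_Py_pow 25 5).C_mul 522)).sub
    ((isHomogeneous_Px_pow_mul_Py_pow 20 10).C_mul 10005)).sub
    ((isHomogeneous_Px_pow_mul_Py_pow 10 20).C_mul 10005)).sub
    ((isHomogeneous_Px_pow_mul_Py_pow 5 25).C_mul 522)).add (isHomogeneous_Px_pow_mul_Py_pow 0 30)

theorem eval_vertexForm (p q : ℂ) : eval ![p, q] (vertexForm Px Py) = vertexForm p q := by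
  simp [map_vertexForm, Px, Py]

theorem eval_faceForm (p q : ℂ) : eval ![p, q] (faceForm Px Py) = faceForm p q := by
  simp [map_faceForm, Px, Py]

theorem eval_edgeForm (p q : ℂ) : eval ![p, q] (edgeForm Px Py) = edgeForm p q := by
  simp [map_edgeForm, Px, Py]

theorem vertexForm_ne_zero : vertexForm Px Py ≠ 0 := by
  intro h
  have := eval_vertexForm 1 1
  rw [h, map_zero] at this
  norm_num [vertexForm] at this

end GroundForms

section Span

variable {ε t a : ℂ}

/-- The products of powers of Klein's forms which have degree `d` and contain the form of degree
30 at most once. -/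
def kleinMonomials (d : ℕ) : Set BPoly :=
  {g | ∃ α β γ : ℕ, γ ≤ 1 ∧ 12 * α + 20 * β + 30 * γ = d ∧
    g = vertexForm Px Py ^ α * faceForm Px Py ^ β * edgeForm Px Py ^ γ}

theorem vertexForm_mul_mem_span {g : BPoly} {d : ℕ}
    (hg : g ∈ Submodule.span ℂ (kleinMonomials d)) :
    vertexForm Px Py * g ∈ Submodule.span ℂ (kleinMonomials (12 + d)) := by
  induction hg using Submodule.span_induction with
  | mem g hg =>
    obtain ⟨α, β, γ, hγ, rfl, rfl⟩ := hg
    exact Submodule.subset_span ⟨α + 1, β, γ, hγ, by ring, by ring⟩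
  | zero => simp
  | add g h _ _ hg hh => rw [mul_add]; exact add_mem hg hh
  | smul c g _ hg => rw [mul_smul_comm]; exact Submodule.smul_mem _ _ hg

theorem IsIcosahedralInvariant.mem_span (hε : IsPrimitiveRoot ε 5) (htε : t = -(ε + ε ^ 4))
    (ha : a ^ 2 * (2 + t) = -1) {d : ℕ} (heven : Even d) {f : BPoly} (hd : f.IsHomogeneous d)
    (hf : IsIcosahedralInvariant ε t a f) : f ∈ Submodule.span ℂ (kleinMonomials d) := by
  have ht := golden_of_isPrimitiveRoot hε htε
  have ha0 : a ≠ 0 := by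
    rintro rfl
    norm_num at ha
  have hV := isIcosahedralInvariant_vertexForm hε ht ha
  induction d using Nat.strong_induction_on generalizing f with
  | _ d ih =>
  have main : ∀ f : BPoly, f.IsHomogeneous d → IsIcosahedralInvariant ε t a f →
      eval ![1, 0] f = 0 → f ∈ Submodule.span ℂ (kleinMonomials d) := by
    intro f hd hf h0
    obtain ⟨g, rfl⟩ := hf.vertexForm_dvd hε htε ha0 hd h0
    rcases eq_or_ne g 0 with rfl | hg0
    · simp
    obtain ⟨hle, hg⟩ := isHomogeneous_vertexForm.of_mul_left vertexForm_ne_zero hd hg0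
    have := vertexForm_mul_mem_span (ih (d - 12) (by omega)
      (heven.tsub (by decide)) hg (hV.of_mul_left vertexForm_ne_zero hf))
    rwa [Nat.add_sub_cancel' hle] at this
  by_cases h0 : eval ![1, 0] f = 0
  · exact main f hd hf h0
  obtain ⟨β, γ, hγ, rfl⟩ := hf.degree_eq hε ht ha hd heven h0
  set g := faceForm Px Py ^ β * edgeForm Px Py ^ γ with hg
  have hgd : g.IsHomogeneous (20 * β + 30 * γ) :=
    (isHomogeneous_faceForm.pow β).mul (isHomogeneous_edgeForm.pow γ)
  have hgi : IsIcosahedralInvariant ε t a g :=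
    ((isIcosahedralInvariant_faceForm hε ht ha).pow β).mul
      ((isIcosahedralInvariant_edgeForm hε ht ha).pow γ)
  have hge : eval ![1, 0] g = (-1) ^ β := by
    rw [hg, map_mul, map_pow, map_pow, eval_faceForm, eval_edgeForm]
    simp [faceForm, edgeForm]
  have hgm : g ∈ Submodule.span ℂ (kleinMonomials (20 * β + 30 * γ)) :=
    Submodule.subset_span ⟨0, β, γ, hγ, by ring, by rw [hg, pow_zero, one_mul]⟩
  set c := eval ![1, 0] f * (-1) ^ β with hc
  have := main (f - C c * g) (hd.sub (hgd.C_mul c))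
    (hf.sub ((IsIcosahedralInvariant.const c).mul hgi)) (by
      rw [map_sub, map_mul, eval_C, hge, hc, mul_assoc, ← mul_pow]
      norm_num)
  rw [← sub_add_cancel f (C c * g)]
  refine add_mem this ?_
  rw [← smul_eq_C_mul]
  exact Submodule.smul_mem _ _ hgm

theorem exists_forall_exponents_eq (d : ℕ) : ∃ a b c n : ℕ, ∀ α β γ : ℕ, γ ≤ 1 →
    12 * α + 20 * β + 30 * γ = d →
      ∃ k ≤ n, α = a + 5 * k ∧ β = b + 3 * (n - k) ∧ γ = c := by
  by_cases h : ∃ α β γ : ℕ, γ ≤ 1 ∧ 12 * α + 20 * β + 30 * γ = d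
  · obtain ⟨α₁, β₁, γ₁, h₁, h₂⟩ := h
    refine ⟨α₁ % 5, β₁ % 3, γ₁, α₁ / 5 + β₁ / 3, fun α β γ h₃ h₄ ↦ ⟨α / 5, ?_, ?_, ?_, ?_⟩⟩ <;> omega
  · exact ⟨0, 0, 0, 0, fun α β γ h₃ h₄ ↦ (h ⟨α, β, γ, h₃, h₄⟩).elim⟩

theorem exists_eq_mul_sum_of_mem_span (d : ℕ) : ∃ α β γ n : ℕ,
    ∀ f ∈ Submodule.span ℂ (kleinMonomials d), ∃ p : Polynomial ℂ, p.natDegree ≤ n ∧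
      f = vertexForm Px Py ^ α * faceForm Px Py ^ β * edgeForm Px Py ^ γ *
        ∑ k ∈ Finset.range (n + 1),
          C (p.coeff k) * ((vertexForm Px Py ^ 5) ^ k * (faceForm Px Py ^ 3) ^ (n - k)) := by
  obtain ⟨α, β, γ, n, h⟩ := exists_forall_exponents_eq d
  refine ⟨α, β, γ, n, fun f hf ↦ ?_⟩
  induction hf using Submodule.span_induction with
  | mem g hg =>
    obtain ⟨α', β', γ', hγ, hd, rfl⟩ := hg
    obtain ⟨k, hk, rfl, rfl, rfl⟩ := h _ _ _ hγ hd
    refine ⟨.X ^ k, by simpa using hk, ?_⟩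
    rw [Finset.sum_eq_single k]
    · simp
      ring
    · intro j _ hj
      simp [Polynomial.coeff_X_pow, hj]
    · intro hk'
      exact (hk' (Finset.mem_range_succ_iff.2 hk)).elim
  | zero => exact ⟨0, by simp, by simp⟩
  | add g h _ _ hg hh =>
    obtain ⟨p, hp, rfl⟩ := hg
    obtain ⟨q, hq, rfl⟩ := hh
    refine ⟨p + q, Polynomial.natDegree_add_le_of_degree_le hp hq, ?_⟩
    simp only [Polynomial.coeff_add, C_add, add_mul, Finset.sum_add_distrib, mul_add]
  | smul c g _ hg =>
    obtain ⟨p, hp, rfl⟩ := hg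
    refine ⟨c • p, (Polynomial.natDegree_smul_le _ _).trans hp, ?_⟩
    rw [← mul_smul_comm, Finset.smul_sum]
    simp only [Polynomial.coeff_smul, smul_eq_mul, C_mul, mul_assoc, smul_eq_C_mul]

end Span

section Factorization

theorem exists_sum_eq_prod_linear {n : ℕ} {p : Polynomial ℂ} (hp : p ≠ 0) (hn : p.natDegree ≤ n)
    (U V : BPoly) : ∃ c : ℂ, c ≠ 0 ∧ ∃ lam mu : Fin n → ℂ, (∀ i, (lam i, mu i) ≠ (0, 0)) ∧
      ∑ k ∈ Finset.range (n + 1), C (p.coeff k) * (U ^ k * V ^ (n - k)) =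
        C c * ∏ i, (C (lam i) * U + C (mu i) * V) := by
  induction n generalizing p with
  | zero =>
    refine ⟨p.coeff 0, fun h ↦ hp ?_, ![], ![], fun i ↦ i.elim0, by simp⟩
    rw [Polynomial.eq_C_of_natDegree_le_zero hn, h, Polynomial.C_0]
  | succ n ih =>
    by_cases hpn : p.natDegree ≤ n
    · obtain ⟨c, hc, lam, mu, hlm, h⟩ := ih hp hpn
      refine ⟨c, hc, Fin.cons 0 lam, Fin.cons 1 mu, ?_, ?_⟩
      · intro i
        refine Fin.cases ?_ ?_ i
        · simp
        · simpa using hlm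
      · rw [Finset.sum_range_succ, Polynomial.coeff_eq_zero_of_natDegree_lt (by omega),
          Fin.prod_univ_succ]
        simp only [Fin.cons_zero, Fin.cons_succ]
        rw [mul_left_comm (C c), ← h, Finset.mul_sum, C_0, zero_mul, add_zero]
        refine Finset.sum_congr rfl fun k hk ↦ ?_
        rw [Nat.sub_add_comm (Finset.mem_range_succ_iff.1 hk), C_1]
        ring
    · obtain ⟨r, hr⟩ := IsAlgClosed.exists_root p fun h0 ↦ hpn <| by
        rw [Polynomial.natDegree_eq_zero_iff_degree_le_zero.2 h0.le]
        exact Nat.zero_le n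
      obtain ⟨q, rfl⟩ := Polynomial.dvd_iff_isRoot.2 hr
      have hq : q ≠ 0 := right_ne_zero_of_mul hp
      have hqn : q.natDegree ≤ n := by
        rw [(Polynomial.monic_X_sub_C r).natDegree_mul' hq, Polynomial.natDegree_X_sub_C] at hn
        omega
      obtain ⟨c, hc, lam, mu, hlm, h⟩ := ih hq hqn
      refine ⟨c, hc, Fin.cons 1 lam, Fin.cons (-r) mu, ?_, ?_⟩
      · intro i
        refine Fin.cases ?_ ?_ i
        · simp
        · simpa using hlm
      · rw [Fin.prod_univ_succ]
        simp only [Fin.cons_zero, Fin.cons_succ]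
        rw [mul_left_comm (C c), ← h, add_mul, Finset.mul_sum, Finset.mul_sum]
        simp only [sub_mul, Polynomial.coeff_sub, Polynomial.coeff_C_mul, C_sub,
          Finset.sum_sub_distrib]
        rw [Finset.sum_range_succ', Finset.sum_range_succ (n := n + 1),
          Polynomial.coeff_eq_zero_of_natDegree_lt (n := n + 1) (p := q) (by omega)]
        simp only [Polynomial.coeff_X_mul, Polynomial.coeff_X_mul_zero, mul_zero, C_0, zero_mul,
          add_zero]
        rw [sub_eq_add_neg, ← Finset.sum_neg_distrib]
        refine congrArg₂ (· + ·) (Finset.sum_congr rfl fun k hk ↦ ?_)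
          (Finset.sum_congr rfl fun k hk ↦ ?_)
        · rw [Nat.add_sub_add_right, C_1]
          ring
        · rw [Nat.sub_add_comm (Finset.mem_range_succ_iff.1 hk), C_mul, C_neg]
          ring

end Factorization

section Classification

variable {ε t a : ℂ}

theorem IsIcosahedralInvariant.exists_eq_mul_prod (hε : IsPrimitiveRoot ε 5)
    (htε : t = -(ε + ε ^ 4)) (ha : a ^ 2 * (2 + t) = -1) {d : ℕ} (heven : Even d) {f : BPoly}
    (hf0 : f ≠ 0) (hd : f.IsHomogeneous d) (hf : IsIcosahedralInvariant ε t a f) :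
    ∃ c : ℂ, c ≠ 0 ∧ ∃ (α β γ N : ℕ) (lam mu : Fin N → ℂ), (∀ i, (lam i, mu i) ≠ (0, 0)) ∧
      f = C c * (vertexForm Px Py ^ α * faceForm Px Py ^ β * edgeForm Px Py ^ γ *
        ∏ i, (C (lam i) * vertexForm Px Py ^ 5 + C (mu i) * faceForm Px Py ^ 3)) := by
  obtain ⟨α, β, γ, n, h⟩ := exists_eq_mul_sum_of_mem_span d
  obtain ⟨p, hp, rfl⟩ := h f (hf.mem_span hε htε ha heven hd)
  have hp0 : p ≠ 0 := by
    rintro rfl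
    simp at hf0
  obtain ⟨c, hc, lam, mu, hlm, h⟩ :=
    exists_sum_eq_prod_linear hp0 hp (vertexForm Px Py ^ 5) (faceForm Px Py ^ 3)
  exact ⟨c, hc, α, β, γ, n, lam, mu, hlm, by rw [h, mul_left_comm]⟩

theorem matActHom_eq_self_of_mem_closure {S : Set (SpecialLinearGroup (Fin 2) ℂ)} {f : BPoly}
    (hS : ∀ A ∈ S, matActHom (A : Matrix (Fin 2) (Fin 2) ℂ) f = f)
    {A : SpecialLinearGroup (Fin 2) ℂ} (hA : A ∈ Subgroup.closure S) :
    matActHom (A : Matrix (Fin 2) (Fin 2) ℂ) f = f := by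
  have hmul : ∀ A B : SpecialLinearGroup (Fin 2) ℂ,
      matActHom (A * B : SpecialLinearGroup (Fin 2) ℂ) f = matActHom B (matActHom A f) :=
    fun A B ↦ (matActHom_matActHom B A f).symm
  induction hA using Subgroup.closure_induction with
  | mem A hA => exact hS A hA
  | one => exact matActHom_one f
  | mul A B _ _ hA hB => exact (hmul A B).trans ((congrArg _ hA).trans hB)
  | inv A _ hA =>
    refine (congrArg _ hA).symm.trans ((hmul A A⁻¹).symm.trans ?_)
    rw [mul_inv_cancel]
    exact matActHom_one f

end Classification

/-- Klein's classification of semi-invariants of the binary icosahedral group `I`,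
generated by `diag(ε³, ε²)` (`ε` a primitive 5th root of unity) and
`(1/√5)[[ε-ε⁴, ε³-ε²],[ε³-ε², ε⁴-ε]]`: a nonzero binary form is semi-invariant
under every element of `I` iff it is a nonzero scalar multiple of
`F₁^α F₂^β F₃^γ ∏ᵢ (λᵢ F₁⁵ + μᵢ F₂³)`, where `F₁ = xy(x¹⁰+11x⁵y⁵-y¹⁰)`,
`F₂ = -(x²⁰+y²⁰)+228(x¹⁵y⁵-x⁵y¹⁵)-494x¹⁰y¹⁰`,
`F₃ = (x³⁰+y³⁰)+522(x²⁵y⁵-x⁵y²⁵)-10005(x²⁰y¹⁰+x¹⁰y²⁰)` are the ground forms. -/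
theorem semiInv_icosahedral_iff
    (ε : ℂ) (hε : IsPrimitiveRoot ε 5) (s5 : ℂ) (hs5 : s5 ^ 2 = 5)
    (M₁ M₂ : SpecialLinearGroup (Fin 2) ℂ)
    (hM₁ : (M₁ : Matrix (Fin 2) (Fin 2) ℂ) = !![ε ^ 3, 0; 0, ε ^ 2])
    (hM₂ : (M₂ : Matrix (Fin 2) (Fin 2) ℂ) =
      !![(ε - ε ^ 4) / s5, (ε ^ 3 - ε ^ 2) / s5;
         (ε ^ 3 - ε ^ 2) / s5, (ε ^ 4 - ε) / s5])
    (f : BPoly) (hbf : IsBinaryForm f) :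
    (∀ A : SpecialLinearGroup (Fin 2) ℂ, A ∈ Subgroup.closure {M₁, M₂} →
        SemiInv (A : Matrix (Fin 2) (Fin 2) ℂ) f) ↔
      ∃ c : ℂ, c ≠ 0 ∧ ∃ (α β γ N : ℕ) (lam mu : Fin N → ℂ),
        (∀ i, (lam i, mu i) ≠ (0, 0)) ∧
        f = C c * ((Px * Py * (Px ^ 10 + C 11 * Px ^ 5 * Py ^ 5 - Py ^ 10)) ^ α *
          (-(Px ^ 20 + Py ^ 20) + C 228 * (Px ^ 15 * Py ^ 5 - Px ^ 5 * Py ^ 15) -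
            C 494 * Px ^ 10 * Py ^ 10) ^ β *
          ((Px ^ 30 + Py ^ 30) + C 522 * (Px ^ 25 * Py ^ 5 - Px ^ 5 * Py ^ 25) -
            C 10005 * (Px ^ 20 * Py ^ 10 + Px ^ 10 * Py ^ 20)) ^ γ *
          ∏ i : Fin N,
            (C (lam i) *
                (Px * Py * (Px ^ 10 + C 11 * Px ^ 5 * Py ^ 5 - Py ^ 10)) ^ 5 +
             C (mu i) *
                (-(Px ^ 20 + Py ^ 20) + C 228 * (Px ^ 15 * Py ^ 5 - Px ^ 5 * Py ^ 15) -
                  C 494 * Px ^ 10 * Py ^ 10) ^ 3)) := by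
  obtain ⟨hf0, d, hd⟩ := hbf
  obtain ⟨t, htε⟩ : ∃ t, t = -(ε + ε ^ 4) := ⟨_, rfl⟩
  obtain ⟨a, ha⟩ : ∃ a, a = (ε - ε ^ 4) / s5 := ⟨_, rfl⟩
  have hs0 : s5 ≠ 0 := by
    rintro rfl
    norm_num at hs5
  have has : a * s5 = ε - ε ^ 4 := by rw [ha, div_mul_cancel₀ _ hs0]
  have ht := golden_of_isPrimitiveRoot hε htε
  have hat : a ^ 2 * (2 + t) = -1 := by
    have : a ^ 2 * (2 + t) * s5 ^ 2 = -5 := by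
      rw [show a ^ 2 * (2 + t) * s5 ^ 2 = (a * s5) ^ 2 * (2 + t) by ring, has, htε]
      linear_combination (5 - 5 * ε + 2 * ε ^ 2 - 3 * ε ^ 3 + ε ^ 4 + ε ^ 5 + ε ^ 7 - ε ^ 8) *
        hε.five_sum
    rw [hs5] at this
    linear_combination this / 5
  have hM₂' : (M₂ : Matrix (Fin 2) (Fin 2) ℂ) = !![a, a * t; a * t, -a] := by
    have h₁ : (ε ^ 3 - ε ^ 2) / s5 = a * t := by
      rw [div_eq_iff hs0, mul_right_comm, has, htε]
      linear_combination (-ε ^ 3) * hε.pow_eq_one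
    have h₂ : (ε ^ 4 - ε) / s5 = -a := by
      rw [ha, ← neg_div, neg_sub]
    rw [hM₂, h₁, h₂, ← ha]
  rw [show C 11 = (11 : BPoly) from map_ofNat C 11, show C 228 = (228 : BPoly) from map_ofNat C 228,
    show C 494 = (494 : BPoly) from map_ofNat C 494, show C 522 = (522 : BPoly) from map_ofNat C 522,
    show C 10005 = (10005 : BPoly) from map_ofNat C 10005]
  constructor
  · intro h
    obtain ⟨c₁, -, h₁⟩ := h M₁ (Subgroup.subset_closure (Or.inl rfl))
    obtain ⟨c₂, -, h₂⟩ := h M₂ (Subgroup.subset_closure (Or.inr rfl))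
    rw [matAct_eq_matActHom, hM₁] at h₁
    rw [matAct_eq_matActHom, hM₂'] at h₂
    obtain ⟨heven, hf⟩ := even_and_isIcosahedralInvariant hε htε hat hf0 hd h₁ h₂
    exact hf.exists_eq_mul_prod hε htε hat heven hf0 hd
  · rintro ⟨c, -, α, β, γ, N, lam, mu, -, hf⟩ A hA
    have hV := isIcosahedralInvariant_vertexForm hε ht hat
    have hF := isIcosahedralInvariant_faceForm hε ht hat
    have hE := isIcosahedralInvariant_edgeForm hε ht hat
    have hinv : IsIcosahedralInvariant ε t a f := by
      rw [hf]
      exact (IsIcosahedralInvariant.const c).mul ((((hV.pow α).mul (hF.pow β)).mul (hE.pow γ)).mul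
        (IsIcosahedralInvariant.prod _ fun i ↦ ((IsIcosahedralInvariant.const _).mul (hV.pow 5)).add
          ((IsIcosahedralInvariant.const _).mul (hF.pow 3))))
    refine ⟨1, one_ne_zero, ?_⟩
    rw [C_1, one_mul, matAct_eq_matActHom]
    refine matActHom_eq_self_of_mem_closure ?_ hA
    rintro _ (rfl | rfl)
    · rw [hM₁, hinv.rotation]
    · rw [hM₂', hinv.flip]

end
end
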